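/- Let κ be a consistent positive definite kernel on a locally compact Hausdorff space X and let A_j be a closed set with C(A_j) < ∞. For compact K ⊆ A_j write K^c := A_j \ K and let θ_{K^c} denote the interior equilibrium measure of K^c (minimizing energy over Γ_{K^c} = {ν ∈ ℰ : κ(·,ν) ≥ 1 n.e. in K^c}). Then lim_{K ↑ A_j} ‖θ_{K^c}‖ = 0, where K ranges over the increasing filtered family of compact subsets of A_j. -/

import Mathlib

open MeasureTheory Filter Topology
open scoped ENNReal

variable {X : Type*} [TopologicalSpace X] [MeasurableSpace X] [BorelSpace X]

/-- The potential `κ(·,ν)(x) = ∫ κ(x,y) dν(y)` of a positive measure. -/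
noncomputable def pot (κ : X → X → ℝ≥0∞) (ν : Measure X) (x : X) : ℝ≥0∞ :=
  ∫⁻ y, κ x y ∂ν

/-- The mutual energy `κ(μ,ν) = ∬ κ d(μ ⊗ ν)` of two positive measures. -/
noncomputable def mutE (κ : X → X → ℝ≥0∞) (μ ν : Measure X) : ℝ≥0∞ :=
  ∫⁻ x, pot κ ν x ∂μ

/-- A positive measure has finite energy if `κ(μ,μ) < ∞`. -/
def FinE (κ : X → X → ℝ≥0∞) (μ : Measure X) : Prop := mutE κ μ μ < ⊤

/-- The squared energy seminorm `‖μ − ν‖²` of the difference of two positive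
measures of finite energy. -/
noncomputable def distSq (κ : X → X → ℝ≥0∞) (μ ν : Measure X) : ℝ :=
  (mutE κ μ μ).toReal + (mutE κ ν ν).toReal - 2 * (mutE κ μ ν).toReal

/-- `κ` is positive definite: the energy of a difference of finite-energy
positive measures is nonnegative. -/
def PosDefK (κ : X → X → ℝ≥0∞) : Prop :=
  ∀ μ ν : Measure X, FinE κ μ → FinE κ ν → 0 ≤ distSq κ μ ν

/-- The interior capacity `C(E) = 1 / inf {κ(ν,ν) : ν ≥ 0 concentrated on E, ν(E) = 1}`. -/
noncomputable def cap (κ : X → X → ℝ≥0∞) (E : Set X) : ℝ≥0∞ :=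
  (⨅ ν ∈ {ν : Measure X | ν Eᶜ = 0 ∧ ν E = 1}, mutE κ ν ν)⁻¹

/-- The (topological) support of a measure. -/
def msupport (ν : Measure X) : Set X := {x | ∀ U ∈ 𝓝 x, ν U ≠ 0}

/-- `ν₀` is a vague cluster point of the net `μ` along `l`. -/
def VagueClusterPt {ι : Type*} (l : Filter ι) (μ : ι → Measure X)
    (ν₀ : Measure X) : Prop :=
  ∀ ε > (0 : ℝ), ∀ G : Finset (ContinuousMap X ℝ), (∀ f ∈ G, HasCompactSupport f) →
    ∃ᶠ s in l, ∀ f ∈ G, |(∫ y, f y ∂(μ s)) - ∫ y, f y ∂ν₀| < ε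

/-- `κ` is consistent (Fuglede): every strong Cauchy net of positive
finite-energy measures converges strongly to each of its vague cluster points. -/
def Consistent (κ : X → X → ℝ≥0∞) : Prop :=
  ∀ (ι : Type) (l : Filter ι), l.NeBot → ∀ μ : ι → Measure X,
    (∀ s, FinE κ (μ s)) →
    Tendsto (fun p : ι × ι => distSq κ (μ p.1) (μ p.2)) (l ×ˢ l) (𝓝 0) →
    ∀ ν₀ : Measure X, VagueClusterPt l μ ν₀ →
      Tendsto (fun s => distSq κ (μ s) ν₀) l (𝓝 0)

set_option linter.unusedSectionVars false

theorem tau_lintegral {ι : Type*} [Nonempty ι] (μ : Measure X) [IsFiniteMeasure μ]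
    [μ.InnerRegular] (F : ι → X → ℝ≥0∞) (hF : ∀ i, LowerSemicontinuous (F i))
    (hd : Directed (· ≤ ·) F) :
    ∫⁻ x, ⨆ i, F i x ∂μ = ⨆ i, ∫⁻ x, F i x ∂μ := by
  have hm : ∀ i, Measurable (F i) := fun i => (hF i).measurable
  refine le_antisymm ?_ (iSup_lintegral_le F)
  set R := ⨆ i, ∫⁻ x, F i x ∂μ with hR
  by_cases hRt : R = ⊤
  · rw [hRt]; exact le_top
  have hfl : LowerSemicontinuous (fun x => ⨆ i, F i x) := lowerSemicontinuous_iSup hF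
  obtain ⟨u, -, hu2, hu3⟩ := exists_seq_tendsto_sSup (S := Set.range fun i => ∫⁻ x, F i x ∂μ)
    (Set.range_nonempty _) (OrderTop.bddAbove _)
  choose i hi using hu3
  have hdom : ∀ n, ∃ k, partialSups (fun n => F (i n)) n ≤ F k := by
    intro n
    induction n with
    | zero => exact ⟨i 0, by simp⟩
    | succ n ih =>
      obtain ⟨k, hk⟩ := ih
      obtain ⟨l, hl1, hl2⟩ := hd k (i (n+1))
      exact ⟨l, by rw [partialSups_add_one]; exact sup_le (hk.trans hl1) hl2⟩
  have hpm : ∀ n, Measurable (partialSups (fun n => F (i n)) n) := by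
    intro n
    induction n with
    | zero => simpa using hm _
    | succ n ih => rw [partialSups_add_one]; exact ih.sup (hm _)
  set g : X → ℝ≥0∞ := fun x => ⨆ n, partialSups (fun n => F (i n)) n x with hg
  have hgm : Measurable g := Measurable.iSup hpm
  have hgR : R ≤ ∫⁻ x, g x ∂μ := by
    have : R = sSup (Set.range fun i => ∫⁻ x, F i x ∂μ) := rfl
    rw [this]
    refine le_of_tendsto hu2 (Eventually.of_forall fun n => ?_)
    rw [← hi n]
    refine lintegral_mono fun x => ?_
    exact le_trans (le_partialSups (fun n => F (i n)) n x) (le_iSup (fun n => partialSups (fun n => F (i n)) n x) n)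
  have hmax : ∀ j, ∫⁻ x, max (g x) (F j x) ∂μ ≤ R := by
    intro j
    have : ∀ x, max (g x) (F j x) = ⨆ n, max (partialSups (fun n => F (i n)) n x) (F j x) := by
      intro x; rw [hg]; exact iSup_sup
    simp_rw [this]
    rw [lintegral_iSup (fun n => (hpm n).max (hm j))]
    · refine iSup_le fun n => ?_
      obtain ⟨k, hk⟩ := hdom n
      obtain ⟨l, hl1, hl2⟩ := hd k j
      exact (lintegral_mono fun x => max_le ((hk x).trans (hl1 x)) (hl2 x)).trans
        (le_iSup (fun i => ∫⁻ x, F i x ∂μ) l)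
    · intro a b hab x
      exact max_le_max ((partialSups (fun n => F (i n))).monotone hab x) le_rfl
  have hgeq : ∀ j, g =ᵐ[μ] fun x => max (g x) (F j x) := by
    intro j
    refine ae_eq_of_ae_le_of_lintegral_le (Eventually.of_forall fun x => le_max_left _ _) ?_
      (hgm.max (hm j)).aemeasurable ((hmax j).trans hgR)
    obtain j0 : ι := Classical.arbitrary ι
    exact ne_top_of_le_ne_top hRt ((lintegral_mono fun x => le_max_left _ _).trans (hmax j0))
  have hgle : ∫⁻ x, g x ∂μ ≤ R := by
    obtain j0 : ι := Classical.arbitrary ι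
    exact (lintegral_mono fun x => le_max_left _ _).trans (hmax j0)
  refine le_trans (lintegral_mono_ae ?_) hgle
  by_contra hcon
  have hpos : μ {x | g x < ⨆ i, F i x} ≠ 0 := by
    intro h0; apply hcon
    rw [ae_iff]; simpa only [not_le] using h0
  have hun : {x | g x < ⨆ i, F i x} ⊆ ⋃ q : ℚ, ({x | g x < ENNReal.ofReal q} ∩ {x | ENNReal.ofReal q < ⨆ i, F i x}) := by
    intro x hx
    obtain ⟨q, _, h1, h2⟩ := ENNReal.lt_iff_exists_rat_btwn.1 hx
    exact Set.mem_iUnion.2 ⟨q, h1, h2⟩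
  have : ∃ q : ℚ, μ ({x | g x < ENNReal.ofReal q} ∩ {x | ENNReal.ofReal q < ⨆ i, F i x}) ≠ 0 := by
    by_contra! hall
    exact hpos (measure_mono_null hun (measure_iUnion_null hall))
  obtain ⟨q, hq⟩ := this
  have hSm : MeasurableSet ({x | g x < ENNReal.ofReal q} ∩ {x | ENNReal.ofReal q < ⨆ i, F i x}) :=
    (measurableSet_lt hgm measurable_const).inter (measurableSet_lt measurable_const hfl.measurable)
  obtain ⟨K, hKS, hK, hKpos⟩ := hSm.exists_lt_isCompact (pos_iff_ne_zero.2 hq)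
  obtain ⟨j, hj⟩ := hK.elim_directed_cover (fun j => {x | ENNReal.ofReal q < F j x})
    (fun j => (hF j).isOpen_preimage _) (by
      intro x hx
      have h2 : ENNReal.ofReal q < ⨆ i, F i x := (hKS hx).2
      obtain ⟨j, hj⟩ := lt_iSup_iff.1 h2
      exact Set.mem_iUnion.2 ⟨j, hj⟩)
    (by
      intro a b
      obtain ⟨c, h1, h2⟩ := hd a b
      exact ⟨c, fun x hx => lt_of_lt_of_le hx (h1 x), fun x hx => lt_of_lt_of_le hx (h2 x)⟩)
  have := hgeq j
  rw [Filter.EventuallyEq, ae_iff] at this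
  refine hKpos.ne' (measure_mono_null ?_ this)
  intro x hx
  have h1 : g x < F j x := lt_trans (hKS hx).1 (hj hx)
  simp only [Set.mem_ofPred_eq]
  intro h
  rw [max_eq_right h1.le] at h
  exact h1.ne h

/-- Finite inner regular measures. -/
class Good (μ : Measure X) : Prop extends IsFiniteMeasure μ, μ.InnerRegular

instance goodZero : Good (0 : Measure X) := {}
instance goodAdd (μ ν : Measure X) [Good μ] [Good ν] : Good (μ + ν) := {}
instance goodRestrict (μ : Measure X) [Good μ] (s : Set X) : Good (μ.restrict s) := {}
instance goodSum {ι : Type*} (μ : ι → Measure X) [∀ i, Good (μ i)] (s : Finset ι) :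
    Good (∑ i ∈ s, μ i) := {}
instance goodSmul (μ : Measure X) [Good μ] (c : NNReal) : Good (c • μ) := {}
theorem goodSmul' (μ : Measure X) [Good μ] (c : ℝ≥0∞) (hc : c ≠ ⊤) : Good (c • μ) := by
  lift c to NNReal using hc
  exact goodSmul μ c

/-- Compactly supported continuous minorants of the kernel. -/
def Hfam (κ : X → X → ℝ≥0∞) : Type _ :=
  {h : X × X → ℝ // Continuous h ∧ HasCompactSupport h ∧ (∀ p, 0 ≤ h p) ∧
    ∀ p, ENNReal.ofReal (h p) ≤ κ p.1 p.2}

instance Hfam.nonempty (κ : X → X → ℝ≥0∞) : Nonempty (Hfam κ) :=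
  ⟨⟨0, continuous_zero, HasCompactSupport.zero, fun _ => le_rfl, by simp⟩⟩

theorem Hfam.sup_exists [T2Space X] (κ : X → X → ℝ≥0∞) (h₁ h₂ : Hfam κ) :
    ∃ h : Hfam κ, ∀ p, h.1 p = max (h₁.1 p) (h₂.1 p) := by
  obtain ⟨f, hf1, hf2, hf3, hf4⟩ := h₁
  obtain ⟨g, hg1, hg2, hg3, hg4⟩ := h₂
  refine ⟨⟨fun p => max (f p) (g p), hf1.max hg1, ?_, fun p => le_max_of_le_left (hf3 p), ?_⟩, fun p => rfl⟩
  · refine HasCompactSupport.of_support_subset_isCompact (hf2.isCompact.union hg2.isCompact) ?_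
    intro p hp
    by_contra hcon
    simp only [Set.mem_union, not_or] at hcon
    apply hp
    simp [image_eq_zero_of_notMem_tsupport hcon.1, image_eq_zero_of_notMem_tsupport hcon.2]
  · intro p
    simp only [ENNReal.ofReal_max]
    exact max_le (hf4 p) (hg4 p)

theorem Hfam.swap_exists (κ : X → X → ℝ≥0∞) (hsym : ∀ x y, κ x y = κ y x) (h : Hfam κ) :
    ∃ h' : Hfam κ, ∀ x y, h'.1 (x, y) = h.1 (y, x) := by
  obtain ⟨f, hf1, hf2, hf3, hf4⟩ := h
  refine ⟨⟨fun p => f p.swap, hf1.comp continuous_swap, ?_, fun p => hf3 _, ?_⟩, fun x y => rfl⟩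
  · exact hf2.comp_homeomorph (Homeomorph.prodComm X X)
  · intro p; rw [hsym]; exact hf4 p.swap

theorem kappa_eq_iSup [T2Space X] [LocallyCompactSpace X] (κ : X → X → ℝ≥0∞)
    (hlsc : LowerSemicontinuous fun p : X × X => κ p.1 p.2) (x y : X) :
    κ x y = ⨆ h : Hfam κ, ENNReal.ofReal (h.1 (x, y)) := by
  refine le_antisymm ?_ (iSup_le fun h => h.2.2.2.2 (x, y))
  refine le_of_forall_lt fun c hc => ?_
  obtain ⟨d, hcd, hd⟩ := exists_between hc
  have hdt : d ≠ ⊤ := (lt_of_lt_of_le hd le_top).ne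
  have hU : IsOpen {p : X × X | d < κ p.1 p.2} := hlsc.isOpen_preimage d
  obtain ⟨f, hf1, hf2, hf3, hf4⟩ := exists_continuous_one_zero_of_isCompact
    (isCompact_singleton (x := (x, y))) hU.isClosed_compl
    (by rw [Set.disjoint_singleton_left]; exact fun h => h hd)
  refine lt_of_lt_of_le hcd ?_
  let h : Hfam κ := ⟨fun p => d.toReal * f p, by fun_prop, hf3.mul_left, fun p =>
    mul_nonneg ENNReal.toReal_nonneg (hf4 p).1, by
      intro p
      by_cases hp : d < κ p.1 p.2
      · refine le_trans ?_ hp.le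
        refine le_trans ?_ (ENNReal.ofReal_toReal hdt).le
        exact ENNReal.ofReal_le_ofReal (mul_le_of_le_one_right ENNReal.toReal_nonneg (hf4 p).2)
      · have : f p = 0 := hf2 hp
        simp [this]⟩
  have : ENNReal.ofReal (h.1 (x, y)) = d := by
    have h1 : f (x, y) = 1 := hf1 rfl
    simp [h, h1, ENNReal.ofReal_toReal hdt]
  rw [← this]
  exact le_iSup (fun h : Hfam κ => ENNReal.ofReal (h.1 (x, y))) h

theorem Hfam.slice_cont {κ : X → X → ℝ≥0∞} (h : Hfam κ) (x : X) : Continuous fun y => h.1 (x, y) :=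
  h.2.1.comp (by fun_prop)

theorem Hfam.slice_supp [T2Space X] {κ : X → X → ℝ≥0∞} (h : Hfam κ) (x : X) :
    HasCompactSupport fun y => h.1 (x, y) := by
  refine HasCompactSupport.of_support_subset_isCompact (h.2.2.1.isCompact.image continuous_snd) ?_
  intro y hy
  exact ⟨(x, y), subset_tsupport _ hy, rfl⟩

theorem Hfam.slice_int [T2Space X] {κ : X → X → ℝ≥0∞} (h : Hfam κ) (x : X) (ν : Measure X)
    [IsFiniteMeasure ν] : Integrable (fun y => h.1 (x, y)) ν :=
  (h.slice_cont x).integrable_of_hasCompactSupport (h.slice_supp x)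

/-- Potential of a minorant. -/
noncomputable def hpot {κ : X → X → ℝ≥0∞} (h : Hfam κ) (ν : Measure X) (x : X) : ℝ :=
  ∫ y, h.1 (x, y) ∂ν

theorem hpot_nonneg {κ : X → X → ℝ≥0∞} (h : Hfam κ) (ν : Measure X) (x : X) : 0 ≤ hpot h ν x :=
  integral_nonneg fun _ => h.2.2.2.1 _

theorem hpot_equi {κ : X → X → ℝ≥0∞} (h : Hfam κ) (x₀ : X) (ε : ℝ) (hε : 0 < ε) :
    ∀ᶠ x in 𝓝 x₀, ∀ y, |h.1 (x, y) - h.1 (x₀, y)| ≤ ε := by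
  have hK := h.2.2.1.isCompact.image continuous_snd
  have := hK.eventually_forall_of_forall_eventually (x₀ := x₀)
    (P := fun x y => |h.1 (x, y) - h.1 (x₀, y)| < ε) (by
      intro y _
      have hc : Continuous fun z : X × X => |h.1 (z.1, z.2) - h.1 (x₀, z.2)| :=
        ((h.2.1.comp (by fun_prop)).sub (h.2.1.comp (by fun_prop))).abs
      have := hc.tendsto (x₀, y)
      simp only [sub_self, abs_zero] at this
      exact this.eventually_lt_const hε)
  filter_upwards [this] with x hx y
  by_cases hy : y ∈ Prod.snd '' tsupport h.1
  · exact (hx y hy).le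
  · have hz : ∀ z, h.1 (z, y) = 0 := fun z => by
      by_contra hne
      exact hy ⟨(z, y), subset_tsupport _ hne, rfl⟩
    simp [hz, hε.le]

theorem hpot_sub_le [T2Space X] {κ : X → X → ℝ≥0∞} (h : Hfam κ) (ν : Measure X) [IsFiniteMeasure ν] (x x₀ : X)
    (ε : ℝ) (hx : ∀ y, |h.1 (x, y) - h.1 (x₀, y)| ≤ ε) :
    |hpot h ν x - hpot h ν x₀| ≤ ε * ν.real Set.univ := by
  unfold hpot
  rw [← integral_sub (h.slice_int x ν) (h.slice_int x₀ ν), ← Real.norm_eq_abs]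
  exact norm_integral_le_of_norm_le_const (Eventually.of_forall hx)

theorem hpot_cont [T2Space X] {κ : X → X → ℝ≥0∞} (h : Hfam κ) (ν : Measure X) [IsFiniteMeasure ν] :
    Continuous (hpot h ν) := by
  rw [continuous_iff_continuousAt]
  intro x₀
  rw [ContinuousAt, Metric.tendsto_nhds]
  intro ε hε
  have hpos : (0:ℝ) < ν.real Set.univ + 1 := by positivity
  filter_upwards [hpot_equi h x₀ (ε / (ν.real Set.univ + 1)) (by positivity)] with x hx
  rw [Real.dist_eq]
  refine (hpot_sub_le h ν x x₀ _ hx).trans_lt ?_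
  rw [div_mul_eq_mul_div, div_lt_iff₀ hpos]
  nlinarith

theorem hpot_supp [T2Space X] {κ : X → X → ℝ≥0∞} (h : Hfam κ) (ν : Measure X) :
    HasCompactSupport (hpot h ν) := by
  refine HasCompactSupport.of_support_subset_isCompact (h.2.2.1.isCompact.image continuous_fst) ?_
  intro x hx
  by_contra hcon
  apply hx
  have : ∀ y, h.1 (x, y) = 0 := fun y => by
    by_contra hne
    exact hcon ⟨(x, y), subset_tsupport _ hne, rfl⟩
  simp [hpot, this]

theorem hpot_int [T2Space X] {κ : X → X → ℝ≥0∞} (h : Hfam κ) (μ ν : Measure X) [IsFiniteMeasure ν]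
    [IsFiniteMeasure μ] : Integrable (hpot h ν) μ :=
  (hpot_cont h ν).integrable_of_hasCompactSupport (hpot_supp h ν)

theorem ofReal_hpot [T2Space X] {κ : X → X → ℝ≥0∞} (h : Hfam κ) (ν : Measure X) [IsFiniteMeasure ν] (x : X) :
    ENNReal.ofReal (hpot h ν x) = ∫⁻ y, ENNReal.ofReal (h.1 (x, y)) ∂ν :=
  ofReal_integral_eq_lintegral_ofReal (h.slice_int x ν) (Eventually.of_forall fun _ => h.2.2.2.1 _)

theorem ofReal_hpot_le [T2Space X] {κ : X → X → ℝ≥0∞} (h : Hfam κ) (ν : Measure X) [IsFiniteMeasure ν] (x : X) :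
    ENNReal.ofReal (hpot h ν x) ≤ pot κ ν x := by
  rw [ofReal_hpot]
  exact lintegral_mono fun y => h.2.2.2.2 (x, y)

theorem pot_eq_iSup [T2Space X] [LocallyCompactSpace X] (κ : X → X → ℝ≥0∞)
    (hlsc : LowerSemicontinuous fun p : X × X => κ p.1 p.2) (ν : Measure X) [Good ν] (x : X) :
    pot κ ν x = ⨆ h : Hfam κ, ENNReal.ofReal (hpot h ν x) := by
  unfold pot
  simp_rw [kappa_eq_iSup κ hlsc x, ofReal_hpot]
  refine tau_lintegral ν (fun (h : Hfam κ) y => ENNReal.ofReal (h.1 (x, y))) (fun h => ?_) ?_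
  · exact (ENNReal.continuous_ofReal.comp (h.slice_cont x)).lowerSemicontinuous
  · intro a b
    obtain ⟨c, hc⟩ := Hfam.sup_exists κ a b
    exact ⟨c, fun y => ENNReal.ofReal_le_ofReal (by simp [hc]),
      fun y => ENNReal.ofReal_le_ofReal (by simp [hc])⟩

theorem pot_lsc [T2Space X] [LocallyCompactSpace X] (κ : X → X → ℝ≥0∞)
    (hlsc : LowerSemicontinuous fun p : X × X => κ p.1 p.2) (ν : Measure X) [Good ν] :
    LowerSemicontinuous (pot κ ν) := by
  have : pot κ ν = fun x => ⨆ h : Hfam κ, ENNReal.ofReal (hpot h ν x) :=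
    funext (pot_eq_iSup κ hlsc ν)
  rw [this]
  exact lowerSemicontinuous_iSup fun h =>
    (ENNReal.continuous_ofReal.comp (hpot_cont h ν)).lowerSemicontinuous

theorem ofReal_J [T2Space X] {κ : X → X → ℝ≥0∞} (h : Hfam κ) (μ ν : Measure X) [IsFiniteMeasure ν]
    [IsFiniteMeasure μ] :
    ENNReal.ofReal (∫ x, hpot h ν x ∂μ) = ∫⁻ x, ENNReal.ofReal (hpot h ν x) ∂μ :=
  ofReal_integral_eq_lintegral_ofReal (hpot_int h μ ν) (Eventually.of_forall fun _ => hpot_nonneg h ν _)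

theorem ofReal_J_le [T2Space X] {κ : X → X → ℝ≥0∞} (h : Hfam κ) (μ ν : Measure X) [IsFiniteMeasure ν]
    [IsFiniteMeasure μ] :
    ENNReal.ofReal (∫ x, hpot h ν x ∂μ) ≤ mutE κ μ ν := by
  rw [ofReal_J]
  exact lintegral_mono fun x => ofReal_hpot_le h ν x

theorem mutE_eq_iSup [T2Space X] [LocallyCompactSpace X] (κ : X → X → ℝ≥0∞)
    (hlsc : LowerSemicontinuous fun p : X × X => κ p.1 p.2) (μ ν : Measure X) [Good μ] [Good ν] :
    mutE κ μ ν = ⨆ h : Hfam κ, ENNReal.ofReal (∫ x, hpot h ν x ∂μ) := by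
  unfold mutE
  simp_rw [pot_eq_iSup κ hlsc ν, ofReal_J]
  refine tau_lintegral μ (fun (h : Hfam κ) x => ENNReal.ofReal (hpot h ν x)) (fun h => ?_) ?_
  · exact (ENNReal.continuous_ofReal.comp (hpot_cont h ν)).lowerSemicontinuous
  · intro a b
    obtain ⟨c, hc⟩ := Hfam.sup_exists κ a b
    exact ⟨c, fun y => ENNReal.ofReal_le_ofReal (integral_mono (a.slice_int y ν) (c.slice_int y ν) fun z => by simp [hc]),
      fun y => ENNReal.ofReal_le_ofReal (integral_mono (b.slice_int y ν) (c.slice_int y ν) fun z => by simp [hc])⟩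

theorem J_swap [T2Space X] {κ : X → X → ℝ≥0∞} (h h' : Hfam κ)
    (hh : ∀ x y, h'.1 (x, y) = h.1 (y, x)) (μ ν : Measure X) [IsFiniteMeasure ν]
    [IsFiniteMeasure μ] : ∫ x, hpot h ν x ∂μ = ∫ y, hpot h' μ y ∂ν := by
  unfold hpot
  simp_rw [hh]
  exact integral_integral_swap_of_hasCompactSupport (f := fun x y => h.1 (x, y)) h.2.1 h.2.2.1

theorem mutE_comm [T2Space X] [LocallyCompactSpace X] (κ : X → X → ℝ≥0∞)
    (hsym : ∀ x y, κ x y = κ y x)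
    (hlsc : LowerSemicontinuous fun p : X × X => κ p.1 p.2) (μ ν : Measure X) [Good μ] [Good ν] :
    mutE κ μ ν = mutE κ ν μ := by
  have key : ∀ (μ ν : Measure X) [Good μ] [Good ν], mutE κ μ ν ≤ mutE κ ν μ := by
    intro μ ν _ _
    rw [mutE_eq_iSup κ hlsc]
    refine iSup_le fun h => ?_
    obtain ⟨h', hh⟩ := Hfam.swap_exists κ hsym h
    rw [J_swap h h' hh]
    exact ofReal_J_le h' ν μ
  exact le_antisymm (key μ ν) (key ν μ)

theorem pot_add (κ : X → X → ℝ≥0∞) (ν₁ ν₂ : Measure X) (x : X) :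
    pot κ (ν₁ + ν₂) x = pot κ ν₁ x + pot κ ν₂ x := lintegral_add_measure _ _ _

theorem pot_smul (κ : X → X → ℝ≥0∞) (c : ℝ≥0∞) (ν : Measure X) (x : X) :
    pot κ (c • ν) x = c * pot κ ν x := by
  simp [pot]

theorem pot_mono (κ : X → X → ℝ≥0∞) {ν₁ ν₂ : Measure X} (h : ν₁ ≤ ν₂) (x : X) :
    pot κ ν₁ x ≤ pot κ ν₂ x := lintegral_mono' h le_rfl

theorem mutE_add_left (κ : X → X → ℝ≥0∞) (μ₁ μ₂ ν : Measure X) :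
    mutE κ (μ₁ + μ₂) ν = mutE κ μ₁ ν + mutE κ μ₂ ν := lintegral_add_measure _ _ _

theorem mutE_smul_left (κ : X → X → ℝ≥0∞) (c : ℝ≥0∞) (μ ν : Measure X) :
    mutE κ (c • μ) ν = c * mutE κ μ ν := by
  simp [mutE]

theorem mutE_mono (κ : X → X → ℝ≥0∞) {μ₁ μ₂ ν₁ ν₂ : Measure X} (h : μ₁ ≤ μ₂) (h' : ν₁ ≤ ν₂) :
    mutE κ μ₁ ν₁ ≤ mutE κ μ₂ ν₂ := lintegral_mono' h fun x => pot_mono κ h' x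

section
variable [T2Space X] [LocallyCompactSpace X] {κ : X → X → ℝ≥0∞}

theorem pot_meas (hlsc : LowerSemicontinuous fun p : X × X => κ p.1 p.2) (ν : Measure X) [Good ν] :
    Measurable (pot κ ν) := (pot_lsc κ hlsc ν).measurable

theorem mutE_add_right (hlsc : LowerSemicontinuous fun p : X × X => κ p.1 p.2)
    (μ ν₁ ν₂ : Measure X) [Good ν₁] :
    mutE κ μ (ν₁ + ν₂) = mutE κ μ ν₁ + mutE κ μ ν₂ := by
  unfold mutE
  simp_rw [pot_add]
  exact lintegral_add_left (pot_meas hlsc ν₁) _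

theorem mutE_smul_right (hlsc : LowerSemicontinuous fun p : X × X => κ p.1 p.2)
    (c : ℝ≥0∞) (μ ν : Measure X) [Good ν] :
    mutE κ μ (c • ν) = c * mutE κ μ ν := by
  unfold mutE
  simp_rw [pot_smul]
  exact lintegral_const_mul _ (pot_meas hlsc ν)

theorem energy_add (hsym : ∀ x y, κ x y = κ y x)
    (hlsc : LowerSemicontinuous fun p : X × X => κ p.1 p.2) (μ ν : Measure X) [Good μ] [Good ν] :
    mutE κ (μ + ν) (μ + ν) = mutE κ μ μ + 2 * mutE κ μ ν + mutE κ ν ν := by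
  rw [mutE_add_left, mutE_add_right hlsc, mutE_add_right hlsc, mutE_comm κ hsym hlsc ν μ]
  ring

theorem energy_smul (hlsc : LowerSemicontinuous fun p : X × X => κ p.1 p.2)
    (c : ℝ≥0∞) (μ : Measure X) [Good μ] :
    mutE κ (c • μ) (c • μ) = c ^ 2 * mutE κ μ μ := by
  rw [mutE_smul_left, mutE_smul_right hlsc]; ring
end

/-- Vague convergence along a filter. -/
def VLim {ι : Type*} (U : Filter ι) (τ : ι → Measure X) (ν : Measure X) : Prop :=
  ∀ f : X → ℝ, Continuous f → HasCompactSupport f →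
    Tendsto (fun s => ∫ x, f x ∂(τ s)) U (𝓝 (∫ x, f x ∂ν))

theorem VLim.cluster {ι : Type*} {U : Filter ι} [NeBot U] {τ : ι → Measure X} {ν : Measure X}
    (h : VLim U τ ν) : VagueClusterPt U τ ν := by
  intro ε hε G hG
  refine Eventually.frequently ?_
  rw [Filter.eventually_all_finset]
  intro f hf
  have := (h f f.continuous (hG f hf))
  rw [Metric.tendsto_nhds] at this
  exact this ε hε

section
variable [T2Space X] [LocallyCompactSpace X]
open scoped CompactlySupported

theorem exists_vlim {ι : Type*} (U : Ultrafilter ι) (τ : ι → Measure X)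
    [∀ s, IsFiniteMeasure (τ s)] (C : NNReal) (hC : ∀ s, τ s Set.univ ≤ C) :
    ∃ ν : Measure X, Good ν ∧ ν Set.univ ≤ C ∧ VLim U τ ν := by
  have hCr : ∀ s, (τ s).real Set.univ ≤ C := fun s => by
    have := ENNReal.toReal_mono (by simp) (hC s)
    simpa [Measure.real] using this
  have hbd : ∀ f : C_c(X, ℝ), ∃ L : ℝ, Tendsto (fun s => ∫ x, f x ∂(τ s)) U (𝓝 L) := by
    intro f
    obtain ⟨B, hB⟩ := f.continuous.bounded_above_of_compact_support f.hasCompactSupport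
    have hB0 : ∀ s, ‖∫ x, f x ∂(τ s)‖ ≤ |B| * C := by
      intro s
      refine (norm_integral_le_of_norm_le_const (Eventually.of_forall hB)).trans ?_
      exact mul_le_mul (le_abs_self B) (hCr s) (by positivity) (abs_nonneg B)
    have hK : IsCompact (Set.Icc (-(|B| * C)) (|B| * C)) := isCompact_Icc
    obtain ⟨L, -, hL⟩ := hK.ultrafilter_le_nhds (U.map (fun s => ∫ x, f x ∂(τ s))) (by
      rw [le_principal_iff]
      refine Filter.mem_map.2 (Eventually.of_forall fun s => ?_)
      have := hB0 s
      rw [Real.norm_eq_abs, abs_le] at this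
      exact this)
    exact ⟨L, hL⟩
  choose L hL using hbd
  let Λ : C_c(X, ℝ) →ₚ[ℝ] ℝ :=
  { toFun := L
    map_add' f g := by
      refine tendsto_nhds_unique (hL (f + g)) ?_
      have := (hL f).add (hL g)
      refine this.congr fun s => ?_
      exact (integral_add f.integrable g.integrable).symm
    map_smul' c f := by
      refine tendsto_nhds_unique (hL (c • f)) ?_
      have := (hL f).const_mul c
      refine this.congr fun s => ?_
      exact (integral_smul c _).symm
    monotone' f g hfg := by
      refine le_of_tendsto_of_tendsto' (hL f) (hL g) fun s => ?_
      exact integral_mono f.integrable g.integrable hfg }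
  have hΛ : ∀ f, Λ f = L f := fun f => rfl
  set ν := RealRMK.rieszMeasure Λ with hν
  have hmass : ν Set.univ ≤ C := by
    rw [isOpen_univ.measure_eq_iSup_isCompact ν]
    refine iSup₂_le fun K _ => iSup_le fun hK => ?_
    obtain ⟨f, hf1, -, hf3, hf4⟩ := exists_continuous_one_zero_of_isCompact hK isClosed_empty
      (Set.disjoint_empty K)
    let F : C_c(X, ℝ) := ⟨f, hf3⟩
    refine (RealRMK.rieszMeasure_le_of_eq_one Λ (f := F) (fun x => (hf4 x).1) hK
      (fun x hx => hf1 hx)).trans ?_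
    rw [hΛ]
    refine ENNReal.ofReal_le_of_le_toReal ?_
    refine le_of_tendsto (hL F) (Eventually.of_forall fun s => ?_)
    calc ∫ x, F x ∂(τ s) ≤ ∫ x, (1:ℝ) ∂(τ s) := integral_mono F.integrable (integrable_const _) fun x => (hf4 x).2
      _ = (τ s).real Set.univ := by simp
      _ ≤ C := hCr s
      _ = _ := by simp
  have hfin : IsFiniteMeasure ν := ⟨lt_of_le_of_lt hmass (by simp)⟩
  refine ⟨ν, {}, hmass, ?_⟩
  intro f hf1 hf2
  have := hL ⟨⟨f, hf1⟩, hf2⟩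
  rw [← hΛ, ← RealRMK.integral_rieszMeasure] at this
  exact this

variable {κ : X → X → ℝ≥0∞} {ι : Type*} {U : Filter ι} {τ : ι → Measure X} {ν : Measure X}

theorem VLim.J [∀ s, IsFiniteMeasure (τ s)] [IsFiniteMeasure ν] (h : VLim U τ ν)
    (C : NNReal) (hC : ∀ s, τ s Set.univ ≤ C) (hν : ν Set.univ ≤ C) (k : Hfam κ) :
    Tendsto (fun s => ∫ x, hpot k (τ s) x ∂(τ s)) U (𝓝 (∫ x, hpot k ν x ∂ν)) := by
  have hCr : ∀ s, (τ s).real Set.univ ≤ C := fun s => by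
    have := ENNReal.toReal_mono (by simp) (hC s)
    simpa [Measure.real] using this
  have hνr : ν.real Set.univ ≤ C := by
    have := ENNReal.toReal_mono (by simp) hν
    simpa [Measure.real] using this
  have hunif : ∀ δ > 0, ∀ᶠ s in U, ∀ x, |hpot k (τ s) x - hpot k ν x| ≤ δ := by
    intro δ hδ
    have hK := k.2.2.1.isCompact.image continuous_fst
    have : ∀ᶠ s in U, ∀ x ∈ Prod.fst '' tsupport k.1, |hpot k (τ s) x - hpot k ν x| ≤ δ := by
      refine hK.induction_on (p := fun S => ∀ᶠ s in U, ∀ x ∈ S, |hpot k (τ s) x - hpot k ν x| ≤ δ) ?_ ?_ ?_ ?_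
      · simp
      · intro s t hst ht
        filter_upwards [ht] with i hi x hx using hi x (hst hx)
      · intro s t hs ht
        filter_upwards [hs, ht] with i h1 h2 x hx
        exact hx.elim (h1 x) (h2 x)
      · intro x₀ _
        set η := δ / (3 * (C + 1)) with hη
        have hC1 : (0:ℝ) < 3 * (C + 1) := by positivity
        have hη0 : 0 < η := by positivity
        refine ⟨_, mem_nhdsWithin_of_mem_nhds (hpot_equi k x₀ η hη0), ?_⟩
        have hp := h (fun y => k.1 (x₀, y)) (k.slice_cont x₀) (k.slice_supp x₀)
        rw [Metric.tendsto_nhds] at hp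
        filter_upwards [hp (δ/3) (by positivity)] with s hs x hx
        have h1 := hpot_sub_le k (τ s) x x₀ η hx
        have h2 := hpot_sub_le k ν x x₀ η hx
        have h3 : η * (τ s).real Set.univ ≤ δ / 3 := by
          calc η * (τ s).real Set.univ ≤ η * (C + 1) := by gcongr; linarith [hCr s]
            _ = δ / 3 := by rw [hη]; field_simp
        have h4 : η * ν.real Set.univ ≤ δ / 3 := by
          calc η * ν.real Set.univ ≤ η * (C + 1) := by gcongr; linarith
            _ = δ / 3 := by rw [hη]; field_simp
        have h5 : |hpot k (τ s) x₀ - hpot k ν x₀| < δ / 3 := hs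
        rw [abs_le] at h1 h2 ⊢
        rw [abs_lt] at h5
        constructor <;> linarith [h1.1, h1.2, h2.1, h2.2, h5.1, h5.2]
    filter_upwards [this] with s hs x
    by_cases hx : x ∈ Prod.fst '' tsupport k.1
    · exact hs x hx
    · have : ∀ y, k.1 (x, y) = 0 := fun y => by
        by_contra hne
        exact hx ⟨(x, y), subset_tsupport _ hne, rfl⟩
      simp [hpot, this, hδ.le]
  have hlim := h (hpot k ν) (hpot_cont k ν) (hpot_supp k ν)
  rw [Metric.tendsto_nhds] at hlim ⊢
  intro ε hε
  filter_upwards [hlim (ε/2) (by positivity), hunif (ε / (2 * (C + 1))) (by positivity)] with s h1 h2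
  have h3 : |(∫ x, hpot k (τ s) x ∂(τ s)) - ∫ x, hpot k ν x ∂(τ s)| ≤ ε / (2 * (C + 1)) * (τ s).real Set.univ := by
    rw [← integral_sub (hpot_int k _ _) (hpot_int k _ _), ← Real.norm_eq_abs]
    exact norm_integral_le_of_norm_le_const (Eventually.of_forall h2)
  have h4 : ε / (2 * (C + 1)) * (τ s).real Set.univ ≤ ε / 2 := by
    calc ε / (2 * (C + 1)) * (τ s).real Set.univ ≤ ε / (2 * (C + 1)) * (C + 1) := by
          gcongr; linarith [hCr s]
      _ = ε / 2 := by field_simp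
  rw [Real.dist_eq] at h1 ⊢
  rw [abs_le] at h3
  rw [abs_lt] at h1 ⊢
  constructor <;> linarith [h1.1, h1.2, h3.1, h3.2]

theorem VLim.energy_le [NeBot U] [∀ s, IsFiniteMeasure (τ s)] [Good ν] (h : VLim U τ ν)
    (hlsc : LowerSemicontinuous fun p : X × X => κ p.1 p.2)
    (C : NNReal) (hC : ∀ s, τ s Set.univ ≤ C) (hν : ν Set.univ ≤ C) (D : ℝ≥0∞)
    (hD : ∀ s, mutE κ (τ s) (τ s) ≤ D) : mutE κ ν ν ≤ D := by
  rw [mutE_eq_iSup κ hlsc]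
  refine iSup_le fun k => ?_
  have := (ENNReal.continuous_ofReal.tendsto _).comp (h.J C hC hν k)
  exact le_of_tendsto this (Eventually.of_forall fun s => (ofReal_J_le k (τ s) (τ s)).trans (hD s))

theorem VLim.mutE_le [NeBot U] [∀ s, IsFiniteMeasure (τ s)] [Good ν] (h : VLim U τ ν)
    (hlsc : LowerSemicontinuous fun p : X × X => κ p.1 p.2) (a : Measure X) [Good a] (D : ℝ≥0∞)
    (hD : ∀ s, mutE κ (τ s) a ≤ D) : mutE κ ν a ≤ D := by
  rw [mutE_eq_iSup κ hlsc]
  refine iSup_le fun k => ?_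
  have := (ENNReal.continuous_ofReal.tendsto _).comp (h (hpot k a) (hpot_cont k a) (hpot_supp k a))
  exact le_of_tendsto this (Eventually.of_forall fun s => (ofReal_J_le k (τ s) a).trans (hD s))

theorem VLim.open_null [NeBot U] [∀ s, IsFiniteMeasure (τ s)] [Good ν] (h : VLim U τ ν)
    (V : Set X) (hV : IsOpen V) (h0 : ∀ᶠ s in U, τ s V = 0) : ν V = 0 := by
  by_contra hne
  obtain ⟨K, hKV, hK, hKpos⟩ := hV.measurableSet.exists_lt_isCompact (μ := ν) (pos_iff_ne_zero.2 hne)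
  obtain ⟨f, hf1, hf2, hf3, hf4⟩ := exists_continuous_one_zero_of_isCompact hK hV.isClosed_compl
      (Set.disjoint_compl_right_iff_subset.2 hKV)
  have hl := h f f.continuous hf3
  have hz : ∀ᶠ s in U, ∫ x, f x ∂(τ s) = 0 := by
    filter_upwards [h0] with s hs
    refine integral_eq_zero_of_ae ?_
    refine measure_mono_null ?_ hs
    intro x hx
    by_contra hxV
    exact hx (hf2 hxV)
  have hzero : ∫ x, f x ∂ν = 0 := tendsto_nhds_unique hl ((tendsto_congr' hz).2 tendsto_const_nhds)
  have : ν.real K ≤ ∫ x, f x ∂ν := by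
    calc ν.real K = ∫ x, K.indicator 1 x ∂ν := by rw [integral_indicator_one hK.measurableSet]
      _ ≤ _ := integral_mono ((integrable_const (1:ℝ)).indicator hK.measurableSet)
          (f.continuous.integrable_of_hasCompactSupport hf3) (by
            intro x
            by_cases hx : x ∈ K
            · simp [hx, hf1 hx]
            · simp [hx, (hf4 x).1])
  rw [hzero] at this
  have h2 : 0 < ν.real K := ENNReal.toReal_pos hKpos.ne' (measure_ne_top _ _)
  linarith

theorem VLim.mass_ge [NeBot U] [∀ s, IsFiniteMeasure (τ s)] [Good ν] (h : VLim U τ ν)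
    (K : Set X) (hK : IsCompact K) (m : ℝ≥0∞) (hm : ∀ s, m ≤ τ s K) : m ≤ ν Set.univ := by
  obtain ⟨f, hf1, hf2, hf3, hf4⟩ := exists_continuous_one_zero_of_isCompact hK isClosed_empty
      (Set.disjoint_empty K)
  have hl := h f f.continuous hf3
  have h1 : ∀ s, m ≤ ENNReal.ofReal (∫ x, f x ∂(τ s)) := by
    intro s
    refine (hm s).trans ?_
    rw [← ENNReal.ofReal_toReal (measure_ne_top (τ s) K)]
    refine ENNReal.ofReal_le_ofReal ?_
    calc (τ s).real K = ∫ x, K.indicator 1 x ∂(τ s) := by rw [integral_indicator_one hK.measurableSet]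
      _ ≤ _ := integral_mono ((integrable_const (1:ℝ)).indicator hK.measurableSet)
          (f.continuous.integrable_of_hasCompactSupport hf3) (by
            intro x
            by_cases hx : x ∈ K
            · simp [hx, hf1 hx]
            · simp [hx, (hf4 x).1])
  have h2 : m ≤ ENNReal.ofReal (∫ x, f x ∂ν) :=
    ge_of_tendsto ((ENNReal.continuous_ofReal.tendsto _).comp hl) (Eventually.of_forall h1)
  refine h2.trans ?_
  rw [← ENNReal.ofReal_toReal (measure_ne_top ν Set.univ)]
  refine ENNReal.ofReal_le_ofReal ?_
  calc ∫ x, f x ∂ν ≤ ∫ x, (1:ℝ) ∂ν := integral_mono (f.continuous.integrable_of_hasCompactSupport hf3)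
          (integrable_const _) fun x => (hf4 x).2
      _ = ν.real Set.univ := by simp
end

theorem energy_smul' {κ : X → X → ℝ≥0∞} (c : ℝ≥0∞) (hc : c ≠ ⊤) (μ : Measure X) :
    mutE κ (c • μ) (c • μ) = c ^ 2 * mutE κ μ μ := by
  rw [mutE_smul_left]
  unfold mutE
  simp_rw [pot_smul]
  rw [lintegral_const_mul' _ _ hc]; ring

theorem cap_lower {κ : X → X → ℝ≥0∞} {A : Set X} (hcap : cap κ A < ⊤) :
    ∃ c₀ : ℝ≥0∞, c₀ ≠ 0 ∧ c₀ ≠ ⊤ ∧ ∀ ν : Measure X, ν Aᶜ = 0 → ν A = 1 → c₀ ≤ mutE κ ν ν := by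
  refine ⟨min 1 (⨅ ν ∈ {ν : Measure X | ν Aᶜ = 0 ∧ ν A = 1}, mutE κ ν ν), ?_, ?_, ?_⟩
  · rw [← pos_iff_ne_zero, lt_min_iff]
    refine ⟨one_pos, pos_iff_ne_zero.2 ?_⟩
    unfold cap at hcap
    rw [ENNReal.inv_lt_top] at hcap
    exact hcap.ne'
  · exact ne_top_of_le_ne_top ENNReal.one_ne_top (min_le_left _ _)
  · intro ν h1 h2
    exact (min_le_right _ _).trans (iInf₂_le ν ⟨h1, h2⟩)

theorem cap_zero {κ : X → X → ℝ≥0∞} {S : Set X}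
    (h : ∀ ν : Measure X, ν Sᶜ = 0 → ν S = 1 → mutE κ ν ν = ⊤) : cap κ S = 0 := by
  unfold cap
  rw [ENNReal.inv_eq_zero]
  refine iInf₂_eq_top.2 ?_
  intro ν hν
  exact h ν hν.1 hν.2

theorem distSq_self {κ : X → X → ℝ≥0∞} (μ : Measure X) : distSq κ μ μ = 0 := by
  unfold distSq; ring

section
variable [T2Space X] [LocallyCompactSpace X] {κ : X → X → ℝ≥0∞}

/-- Apply consistency to a constant net. -/
theorem cons_const (hcons : Consistent κ) (μ ν₀ : Measure X) (hμ : FinE κ μ)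
    (h : VLim (pure ()) (fun _ : Unit => μ) ν₀) : distSq κ μ ν₀ = 0 := by
  have := hcons Unit (pure ()) inferInstance (fun _ => μ) (fun _ => hμ) (by
    simp only [distSq_self]; exact tendsto_const_nhds) ν₀ h.cluster
  exact tendsto_nhds_unique tendsto_const_nhds this

theorem normalizeMeas (hlsc : LowerSemicontinuous fun p : X × X => κ p.1 p.2) (ν : Measure X) [Good ν]
    (T : Set X) (hT : MeasurableSet T) (h0 : ν T ≠ 0) (hE : mutE κ ν ν ≠ ⊤) :
    ∃ σ : Measure X, Good σ ∧ σ Set.univ = 1 ∧ σ Tᶜ = 0 ∧ mutE κ σ σ ≠ ⊤ := by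
  have hc : (ν T)⁻¹ ≠ ⊤ := ENNReal.inv_ne_top.2 h0
  refine ⟨(ν T)⁻¹ • ν.restrict T, goodSmul' _ _ hc, ?_, ?_, ?_⟩
  · simp [ENNReal.inv_mul_cancel h0 (measure_ne_top ν T)]
  · simp [Measure.restrict_apply hT.compl]
  · rw [energy_smul hlsc]
    refine ENNReal.mul_ne_top (by simp [h0]) (ne_top_of_le_ne_top hE ?_)
    exact mutE_mono κ Measure.restrict_le_self Measure.restrict_le_self

theorem lemmaR (hlsc : LowerSemicontinuous fun p : X × X => κ p.1 p.2) (hcons : Consistent κ)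
    {A : Set X} (hA : IsClosed A) (hcap : cap κ A < ⊤) (P : Measure X) [Good P]
    (Q Q' : Set X) (hQ : IsCompact Q) (hQQ : Q ⊆ interior Q')
    (hR : ∀ σ : Measure X, Good σ → σ Set.univ = 1 → σ {x ∈ A \ Q | pot κ P x < 1}ᶜ = 0 →
      mutE κ σ σ = ⊤) (K : Set X) (hK : A ∩ Q' ⊆ K) :
    cap κ {x ∈ A \ K | pot κ P x < 1} = 0 := by
  refine cap_zero fun ν h1 h2 => ?_
  by_contra hE
  obtain ⟨c₀, hc0, hct, hc⟩ := cap_lower hcap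
  set S := {x ∈ A \ K | pot κ P x < 1} with hS
  have hSA : S ⊆ A := fun x hx => hx.1.1
  have hνA : ν Aᶜ = 0 := measure_mono_null (Set.compl_subset_compl.2 hSA) h1
  have hνu : ν Set.univ ≤ 1 := by
    rw [← Set.union_compl_self S]
    exact (measure_union_le _ _).trans (by rw [h1, h2, add_zero])
  have hfin : IsFiniteMeasure ν := ⟨lt_of_le_of_lt hνu ENNReal.one_lt_top⟩
  have hνA1 : ν A = 1 := le_antisymm ((measure_mono (Set.subset_univ _)).trans hνu)
    (h2 ▸ measure_mono hSA)
  have hcE := hc ν hνA hνA1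
  obtain ⟨C, hC, hCne⟩ : ∃ C : Set X, IsCompact C ∧ ν C ≠ 0 := by
    by_contra! hall
    have hv : VLim (pure ()) (fun _ : Unit => ν) (0 : Measure X) := by
      intro f _ hf2
      have : ∫ x, f x ∂ν = 0 := by
        refine integral_eq_zero_of_ae (measure_mono_null ?_ (hall _ hf2.isCompact))
        intro x hx
        exact subset_tsupport f hx
      simp only [this, integral_zero_measure]
      exact tendsto_const_nhds
    have := cons_const hcons ν 0 (lt_top_iff_ne_top.2 hE) hv
    simp only [distSq, mutE, pot, lintegral_zero_measure] at this
    simp at this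
    have h3 : mutE κ ν ν = 0 := ((ENNReal.toReal_eq_zero_iff _).1 this).resolve_right hE
    rw [h3] at hcE
    exact hc0 (le_antisymm hcE bot_le)
  have hCres : ν.restrict C Set.univ = ν C := by simp
  obtain ⟨ν', hg, hm', hv⟩ := exists_vlim (pure () : Ultrafilter Unit) (fun _ => ν.restrict C) 1
    (fun _ => by
      rw [hCres]; exact (measure_mono (Set.subset_univ _)).trans (by simpa using hνu))
  have hmass := hv.mass_ge C hC (ν C) (fun _ => by simp)
  have hE' := hv.energy_le hlsc 1 (fun _ => by
      rw [hCres]; exact (measure_mono (Set.subset_univ _)).trans (by simpa using hνu)) hm'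
      (mutE κ ν ν) (fun _ => mutE_mono κ Measure.restrict_le_self Measure.restrict_le_self)
  have hV : ν' (Aᶜ ∪ interior Q') = 0 := by
    refine hv.open_null _ (hA.isOpen_compl.union isOpen_interior) (Eventually.of_forall fun _ => ?_)
    refine le_antisymm ((Measure.restrict_le_self _).trans ?_) bot_le
    refine (measure_mono ?_).trans h1.le
    rintro x (hx | hx) hxS
    · exact hx hxS.1.1
    · exact hxS.1.2 (hK ⟨hxS.1.1, interior_subset hx⟩)
  have hlt : mutE κ (ν.restrict C) P < ν C := by
    have hae : ∀ᵐ x ∂(ν.restrict C), pot κ P x < 1 := by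
      refine ae_restrict_of_ae ?_
      refine measure_mono_null ?_ h1
      intro x hx hxS
      exact hx hxS.2
    have hle : mutE κ (ν.restrict C) P ≤ ν C := by
      calc mutE κ (ν.restrict C) P ≤ ∫⁻ x, 1 ∂(ν.restrict C) := lintegral_mono_ae (hae.mono fun x hx => hx.le)
        _ = ν C := by simp
    have := lintegral_strict_mono (μ := ν.restrict C) (f := pot κ P) (g := fun _ => 1)
      (by rw [Ne, Measure.restrict_eq_zero]; exact hCne) aemeasurable_const
      (ne_top_of_le_ne_top (measure_ne_top ν C) hle) hae
    rw [lintegral_one, hCres] at this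
    exact this
  have hle2 := hv.mutE_le hlsc P (mutE κ (ν.restrict C) P) (fun _ => le_rfl)
  set T := {x ∈ A \ Q | pot κ P x < 1} with hT
  have hTm : MeasurableSet T :=
    (hA.measurableSet.diff hQ.measurableSet).inter (measurableSet_lt (pot_meas hlsc P) measurable_const)
  have hT0 : ν' T ≠ 0 := by
    intro h0
    have hae : ∀ᵐ x ∂ν', 1 ≤ pot κ P x := by
      refine measure_mono_null ?_ (measure_union_null h0 hV)
      intro x hx
      have hx' : pot κ P x < 1 := not_le.1 hx
      by_cases hxA : x ∈ A
      · by_cases hxQ : x ∈ Q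
        · exact Or.inr (Or.inr (hQQ hxQ))
        · exact Or.inl ⟨⟨hxA, hxQ⟩, hx'⟩
      · exact Or.inr (Or.inl hxA)
    have : ν' Set.univ ≤ mutE κ ν' P := by
      calc ν' Set.univ = ∫⁻ x, 1 ∂ν' := by simp
        _ ≤ _ := lintegral_mono_ae hae
    exact absurd (hmass.trans (this.trans hle2)) (not_le.2 hlt)
  obtain ⟨σ, hσ1, hσ2, hσ3, hσ4⟩ := normalizeMeas hlsc ν' T hTm hT0 (ne_top_of_le_ne_top hE hE')
  exact hσ4 (hR σ hσ1 hσ2 hσ3)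

theorem stepLemma (hsym : ∀ x y, κ x y = κ y x)
    (hlsc : LowerSemicontinuous fun p : X × X => κ p.1 p.2)
    (B : Set X) (M : ℝ≥0∞) (hM0 : M ≠ 0)
    (hM : ∀ σ : Measure X, Good σ → σ Set.univ = 1 → σ Bᶜ = 0 → M ≤ mutE κ σ σ) :
    ∃ γ : Measure X, Good γ ∧ γ Bᶜ = 0 ∧ γ Set.univ ≤ M⁻¹ ∧ mutE κ γ γ ≤ 2 * M⁻¹ ∧
      ∀ σ : Measure X, Good σ → σ Set.univ = 1 → σ {x ∈ B | pot κ γ x < 1 / 2}ᶜ = 0 →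
        4 * M ≤ mutE κ σ σ := by
  set T := {σ : Measure X | Good σ ∧ σ Set.univ = 1 ∧ σ Bᶜ = 0} with hT
  set I := ⨅ σ ∈ T, mutE κ σ σ with hI
  have hMI : M ≤ I := le_iInf₂ fun σ hσ => hM σ hσ.1 hσ.2.1 hσ.2.2
  by_cases hIt : I = ⊤
  · refine ⟨0, inferInstance, by simp, by simp, by simp [mutE], ?_⟩
    intro σ h1 h2 h3
    have : I ≤ mutE κ σ σ := iInf₂_le σ ⟨h1, h2, measure_mono_null
      (Set.compl_subset_compl.2 fun x hx => hx.1) h3⟩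
    rw [hIt, top_le_iff] at this
    rw [this]; exact le_top
  have hI0 : I ≠ 0 := fun h => hM0 (le_antisymm (h ▸ hMI) bot_le)
  have hlt : I < I + I / 16 := ENNReal.lt_add_right hIt (by simp [hI0])
  obtain ⟨σ, hσT, hσE⟩ : ∃ σ ∈ T, mutE κ σ σ < I + I / 16 := by
    by_contra! hall
    exact absurd (le_iInf₂ hall) (not_le.2 hlt)
  obtain ⟨hσg, hσ1, hσB⟩ := hσT
  have hIinv : I⁻¹ ≠ ⊤ := ENNReal.inv_ne_top.2 hI0
  have hIM : I⁻¹ ≤ M⁻¹ := ENNReal.inv_le_inv.2 hMI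
  have hgγ : Good (I⁻¹ • σ) := goodSmul' _ _ hIinv
  refine ⟨I⁻¹ • σ, hgγ, by simp [hσB], by simpa [hσ1] using hIM, ?_, ?_⟩
  · rw [energy_smul hlsc]
    calc I⁻¹ ^ 2 * mutE κ σ σ ≤ I⁻¹ ^ 2 * (2 * I) := by
          gcongr
          refine hσE.le.trans ?_
          rw [two_mul]; gcongr
          exact ENNReal.div_le_of_le_mul (le_mul_of_one_le_right bot_le (by norm_num))
      _ = 2 * I⁻¹ * (I⁻¹ * I) := by ring
      _ = 2 * I⁻¹ := by rw [ENNReal.inv_mul_cancel hI0 hIt, mul_one]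
      _ ≤ 2 * M⁻¹ := by gcongr
  · intro σ' h1 h2 h3
    refine le_trans (mul_le_mul_right hMI 4) ?_
    by_cases ht : mutE κ σ' σ' = ⊤
    · rw [ht]; exact le_top
    have hB' : σ' Bᶜ = 0 := measure_mono_null (Set.compl_subset_compl.2 fun x hx => hx.1) h3
    have hcross : mutE κ σ' σ ≤ I / 2 := by
      calc mutE κ σ' σ ≤ ∫⁻ x, I / 2 ∂σ' := by
            refine lintegral_mono_ae (measure_mono_null ?_ h3)
            intro x hx hx'
            apply hx
            have h5 : pot κ (I⁻¹ • σ) x < 1 / 2 := hx'.2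
            rw [pot_smul] at h5
            show pot κ σ x ≤ I / 2
            calc pot κ σ x = I * (I⁻¹ * pot κ σ x) := by
                  rw [← mul_assoc, ENNReal.mul_inv_cancel hI0 hIt, one_mul]
              _ ≤ I * (1 / 2) := by gcongr
              _ = I / 2 := by rw [mul_one_div]
        _ = I / 2 := by simp [h2]
    set s : NNReal := 7 / 8
    set t : NNReal := 1 / 8
    have hst : (s : ℝ≥0∞) + t = 1 := by
      rw [← ENNReal.coe_add]
      norm_num [s, t]
    have hgs : Good ((s : ℝ≥0∞) • σ) := goodSmul' _ _ (by simp)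
    have hgt : Good ((t : ℝ≥0∞) • σ') := goodSmul' _ _ (by simp)
    have hmix : I ≤ mutE κ ((s : ℝ≥0∞) • σ + (t : ℝ≥0∞) • σ') ((s : ℝ≥0∞) • σ + (t : ℝ≥0∞) • σ') := by
      refine iInf₂_le (f := fun σ (_ : σ ∈ T) => mutE κ σ σ) _ ⟨inferInstance, ?_, ?_⟩
      · simp only [Measure.add_apply, Measure.smul_apply, hσ1, h2, smul_eq_mul, mul_one]
        exact hst
      · simp only [Measure.add_apply, Measure.smul_apply, hσB, hB', smul_eq_mul, mul_zero, add_zero]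
    rw [energy_add hsym hlsc, energy_smul hlsc, energy_smul hlsc, mutE_smul_left,
      mutE_smul_right hlsc, mutE_comm κ hsym hlsc σ σ'] at hmix
    have hct : mutE κ σ' σ ≠ ⊤ := ne_top_of_le_ne_top (ENNReal.div_ne_top hIt (by norm_num)) hcross
    have hst' : mutE κ σ σ ≠ ⊤ := (hσE.trans_le le_top).ne
    obtain ⟨i, hi⟩ : ∃ i : NNReal, (i : ℝ≥0∞) = I := ⟨I.toNNReal, ENNReal.coe_toNNReal hIt⟩
    obtain ⟨e, he⟩ : ∃ i : NNReal, (i : ℝ≥0∞) = mutE κ σ' σ' := ⟨_, ENNReal.coe_toNNReal ht⟩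
    obtain ⟨x, hx⟩ : ∃ i : NNReal, (i : ℝ≥0∞) = mutE κ σ' σ := ⟨_, ENNReal.coe_toNNReal hct⟩
    obtain ⟨w, hw⟩ : ∃ i : NNReal, (i : ℝ≥0∞) = mutE κ σ σ := ⟨_, ENNReal.coe_toNNReal hst'⟩
    rw [← hi, ← hw, ← he, ← hx] at hmix
    rw [← hi, ← hx] at hcross
    rw [← hi, ← hw] at hσE
    rw [← hi, ← he]
    have c2 : ((2 : NNReal) : ℝ≥0∞) = 2 := rfl
    have c16 : ((16 : NNReal) : ℝ≥0∞) = 16 := rfl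
    have c4 : ((4 : NNReal) : ℝ≥0∞) = 4 := rfl
    rw [← c2] at hmix hcross
    rw [← c16, ← ENNReal.coe_div (by norm_num)] at hσE
    rw [← ENNReal.coe_div (by norm_num)] at hcross
    rw [← c4]
    norm_cast at hmix hcross hσE ⊢
    rw [← NNReal.coe_le_coe] at hmix hcross ⊢
    rw [← NNReal.coe_lt_coe] at hσE
    simp only [s, t] at hmix
    push_cast at hmix hcross hσE ⊢
    linarith
end

theorem lintegral_add_sum_eq_iSup (a : Measure X) (γ : ℕ → Measure X) (f : X → ℝ≥0∞) :
    ∫⁻ x, f x ∂(a + Measure.sum γ) = ⨆ n, ∫⁻ x, f x ∂(a + ∑ i ∈ Finset.range n, γ i) := by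
  rw [lintegral_add_measure, lintegral_sum_measure, ENNReal.tsum_eq_iSup_nat, ENNReal.add_iSup]
  simp_rw [lintegral_add_measure, lintegral_finsetSum_measure]

section
variable [T2Space X] [LocallyCompactSpace X] {κ : X → X → ℝ≥0∞}

theorem lemmaGamma (hsym : ∀ x y, κ x y = κ y x)
    (hlsc : LowerSemicontinuous fun p : X × X => κ p.1 p.2)
    (D : Set X) (a : Measure X) [Good a] (M : ℝ≥0∞) (hM0 : M ≠ 0)
    (hM : ∀ σ : Measure X, Good σ → σ Set.univ = 1 → σ {x ∈ D | pot κ a x < 1 / 2}ᶜ = 0 →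
      M ≤ mutE κ σ σ) :
    ∃ P : Measure X, Good P ∧ mutE κ P P ≤ mutE κ a a + 4 * M⁻¹ ∧
      ∀ σ : Measure X, Good σ → σ Set.univ = 1 → σ {x ∈ D | pot κ P x < 1 / 2}ᶜ = 0 →
        mutE κ σ σ = ⊤ := by
  let T : ℕ → Type _ := fun j => {P : Measure X // Good P ∧
    ∀ σ : Measure X, Good σ → σ Set.univ = 1 → σ {x ∈ D | pot κ P x < 1 / 2}ᶜ = 0 →
      4 ^ j * M ≤ mutE κ σ σ}
  have step : ∀ (j : ℕ) (P : T j), ∃ γ : Measure X, Good γ ∧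
      γ {x ∈ D | pot κ P.1 x < 1 / 2}ᶜ = 0 ∧ γ Set.univ ≤ (4 ^ j * M)⁻¹ ∧
      mutE κ γ γ ≤ 2 * (4 ^ j * M)⁻¹ ∧
      ∀ σ : Measure X, Good σ → σ Set.univ = 1 → σ {x ∈ D | pot κ (P.1 + γ) x < 1 / 2}ᶜ = 0 →
        4 ^ (j + 1) * M ≤ mutE κ σ σ := by
    intro j P
    obtain ⟨γ, h1, h2, h3, h4, h5⟩ := stepLemma hsym hlsc {x ∈ D | pot κ P.1 x < 1 / 2} (4 ^ j * M)
      (mul_ne_zero (by simp) hM0) P.2.2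
    refine ⟨γ, h1, h2, h3, h4, fun σ g1 g2 g3 => ?_⟩
    rw [pow_succ', mul_assoc]
    refine h5 σ g1 g2 (measure_mono_null (Set.compl_subset_compl.2 ?_) g3)
    rintro x ⟨hx1, hx2⟩
    rw [pot_add] at hx2
    exact ⟨⟨hx1, lt_of_le_of_lt le_self_add hx2⟩, lt_of_le_of_lt le_add_self hx2⟩
  choose γ hγ1 hγ2 hγ3 hγ4 hγ5 using step
  let seq : ∀ j, T j := fun j => Nat.rec (motive := T) ⟨a, inferInstance, by simpa using hM⟩
    (fun j P => ⟨P.1 + γ j P, @goodAdd _ _ _ _ _ P.2.1 (hγ1 j P), hγ5 j P⟩) j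
  have hs0 : (seq 0).1 = a := rfl
  have hsS : ∀ j, (seq (j + 1)).1 = (seq j).1 + γ j (seq j) := fun j => rfl
  set g : ℕ → Measure X := fun j => γ j (seq j) with hg
  have hgood : ∀ j, Good (g j) := fun j => hγ1 j _
  have hseq : ∀ n, (seq n).1 = a + ∑ i ∈ Finset.range n, g i := by
    intro n
    induction n with
    | zero => simp [hs0]
    | succ n ih => rw [hsS, ih, Finset.sum_range_succ, add_assoc]
  set P := a + Measure.sum g with hP
  have hw : ∀ j : ℕ, ((4 : ℝ≥0∞) ^ j * M)⁻¹ = 4 * (4 ^ (j + 1) * M)⁻¹ := by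
    intro j
    have hx : ((4 : ℝ≥0∞) ^ (j + 1) * M)⁻¹ = 4⁻¹ * (4 ^ j * M)⁻¹ := by
      rw [pow_succ', mul_assoc, ENNReal.mul_inv (Or.inl (by norm_num)) (Or.inl (by norm_num))]
    rw [hx, ← mul_assoc,
      ENNReal.mul_inv_cancel (by norm_num) (by norm_num), one_mul]
  have hgs : ∀ n, Good (seq n).1 := fun n => (seq n).2.1
  have hmass : ∀ n, (seq n).1 Set.univ + 2 * (4 ^ n * M)⁻¹ ≤ a Set.univ + 2 * M⁻¹ := by
    intro n
    induction n with
    | zero => simp [hs0]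
    | succ n ih =>
      refine le_trans ?_ ih
      rw [hsS, Measure.add_apply, add_assoc]
      gcongr
      have h3 := hγ3 n (seq n)
      rw [hw n] at h3 ⊢
      refine (add_le_add_left h3 _).trans ?_
      rw [← add_mul, ← mul_assoc]
      gcongr
      norm_num
  have hpotle : ∀ n, P ≥ (seq n).1 := by
    intro n
    rw [hseq, hP]
    refine Measure.le_iff.2 fun s hs => ?_
    simp only [Measure.add_apply, Measure.sum_apply _ hs, Measure.finsetSum_apply]
    gcongr
    exact ENNReal.sum_le_tsum _
  have hPu : P Set.univ ≤ a Set.univ + 2 * M⁻¹ := by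
    have := lintegral_add_sum_eq_iSup a g (fun _ => 1)
    simp only [lintegral_one] at this
    rw [hP, this]
    refine iSup_le fun n => ?_
    rw [← hseq]
    exact le_self_add.trans (hmass n)
  have hPfin : IsFiniteMeasure P := ⟨lt_of_le_of_lt hPu (ENNReal.add_lt_top.2
    ⟨measure_lt_top _ _, ENNReal.mul_lt_top (by norm_num) (by simp [pos_iff_ne_zero, hM0])⟩)⟩
  have hPgood : Good P := {}
  have hEn : ∀ n, mutE κ (seq n).1 (seq n).1 + 4 * (4 ^ n * M)⁻¹ ≤ mutE κ a a + 4 * M⁻¹ := by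
    intro n
    induction n with
    | zero => simp [hs0]
    | succ n ih =>
      refine le_trans ?_ ih
      have hgn := hgs n
      have hgg := hγ1 n (seq n)
      rw [hsS, energy_add hsym hlsc, add_assoc, add_assoc]
      gcongr
      have hc : mutE κ (seq n).1 (γ n (seq n)) ≤ 1 / 2 * (4 ^ n * M)⁻¹ := by
        rw [mutE_comm κ hsym hlsc]
        calc mutE κ (γ n (seq n)) (seq n).1 ≤ ∫⁻ x, 1 / 2 ∂(γ n (seq n)) := by
              refine lintegral_mono_ae (measure_mono_null ?_ (hγ2 n (seq n)))
              intro x hx hx'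
              exact hx hx'.2.le
          _ = 1 / 2 * γ n (seq n) Set.univ := by rw [lintegral_const]
          _ ≤ _ := by gcongr; exact hγ3 n (seq n)
      have h4 := hγ4 n (seq n)
      calc 2 * mutE κ (seq n).1 (γ n (seq n)) + (mutE κ (γ n (seq n)) (γ n (seq n)) + 4 * (4 ^ (n + 1) * M)⁻¹)
          ≤ 2 * (1 / 2 * (4 ^ n * M)⁻¹) + (2 * (4 ^ n * M)⁻¹ + (4 ^ n * M)⁻¹) := by
            rw [← hw n]; gcongr
        _ = 4 * (4 ^ n * M)⁻¹ := by
            rw [← mul_assoc, mul_one_div, ENNReal.div_self (by norm_num) (by norm_num)]; ring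
  refine ⟨P, hPgood, ?_, ?_⟩
  · have hpot : ∀ x, pot κ P x = ⨆ n, pot κ (seq n).1 x := by
      intro x
      have := lintegral_add_sum_eq_iSup a g (κ x)
      simp_rw [← hseq] at this
      exact this
    have hmono : Monotone fun n => (seq n).1 := by
      refine monotone_nat_of_le_succ fun n => ?_
      rw [hsS]
      exact Measure.le_add_right le_rfl
    have h1 : mutE κ P P = ⨆ n, mutE κ (seq n).1 P := by
      have := lintegral_add_sum_eq_iSup a g (pot κ P)
      simp_rw [← hseq] at this
      exact this
    rw [h1]
    refine iSup_le fun n => ?_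
    have h2 : mutE κ (seq n).1 P = ⨆ m, mutE κ (seq n).1 (seq m).1 := by
      unfold mutE
      simp_rw [hpot]
      exact lintegral_iSup (fun m => @pot_meas _ _ _ _ _ _ _ hlsc (seq m).1 (hgs m))
        fun m m' hmm x => pot_mono κ (hmono hmm) x
    rw [h2]
    refine iSup_le fun m => ?_
    refine le_trans (mutE_mono κ (hmono (le_max_left n m)) (hmono (le_max_right n m))) ?_
    exact le_self_add.trans (hEn (max n m))
  · intro σ h1 h2 h3
    have hall : ∀ j : ℕ, 4 ^ j * M ≤ mutE κ σ σ := by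
      intro j
      refine (seq j).2.2 σ h1 h2 (measure_mono_null (Set.compl_subset_compl.2 ?_) h3)
      rintro x ⟨hx1, hx2⟩
      exact ⟨hx1, lt_of_le_of_lt (pot_mono κ (hpotle j) x) hx2⟩
    by_contra hne
    have htend : Tendsto (fun j : ℕ => (4 : ℝ≥0∞) ^ j) atTop (𝓝 ⊤) :=
      ENNReal.tendsto_pow_atTop_nhds_top_iff.2 (by norm_num)
    have : Tendsto (fun j : ℕ => (4 : ℝ≥0∞) ^ j * M) atTop (𝓝 (⊤ * M)) :=
      ENNReal.Tendsto.mul_const htend (Or.inl (by simp))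
    rw [ENNReal.top_mul hM0] at this
    exact hne (top_le_iff.1 (le_of_tendsto' this hall))

end

/-- Sets covered by countably many compact sets. -/
def SigB (s : Set X) : Prop := ∃ C : ℕ → Set X, (∀ n, IsCompact (C n)) ∧ s ⊆ ⋃ n, C n

theorem SigB.mono {s t : Set X} (hst : s ⊆ t) (h : SigB t) : SigB s := by
  obtain ⟨C, h1, h2⟩ := h
  exact ⟨C, h1, hst.trans h2⟩

theorem SigB.iUnion {s : ℕ → Set X} (h : ∀ n, SigB (s n)) : SigB (⋃ n, s n) := by
  choose C h1 h2 using h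
  refine ⟨fun k => C k.unpair.1 k.unpair.2, fun k => h1 _ _, ?_⟩
  refine Set.iUnion_subset fun n x hx => ?_
  obtain ⟨m, hm⟩ := Set.mem_iUnion.1 (h2 n hx)
  exact Set.mem_iUnion.2 ⟨Nat.pair n m, by simpa using hm⟩

theorem SigB.of_compact {s : Set X} (h : IsCompact s) : SigB s :=
  ⟨fun _ => s, fun _ => h, fun x hx => Set.mem_iUnion.2 ⟨0, hx⟩⟩

open Classical in
theorem exists_lam : ∃ l : Measure X, (∀ s, MeasurableSet s → SigB s → l s = 0) ∧
    ∀ s, MeasurableSet s → ¬ SigB s → l s = ⊤ := by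
  let l : Measure X := Measure.ofMeasurable (fun s _ => if SigB s then 0 else ⊤)
    (by rw [if_pos (SigB.of_compact isCompact_empty)])
    (by
      intro f hf hd
      by_cases h : ∀ n, SigB (f n)
      · rw [if_pos (SigB.iUnion h)]
        simp [h]
      · obtain ⟨n, hn⟩ := not_forall.1 h
        rw [if_neg (fun h' => hn (h'.mono (Set.subset_iUnion f n)))]
        symm
        rw [← top_le_iff]
        refine le_trans ?_ (ENNReal.le_tsum n)
        rw [if_neg hn])
  refine ⟨l, fun s hs h => ?_, fun s hs h => ?_⟩
  · rw [Measure.ofMeasurable_apply s hs, if_pos h]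
  · rw [Measure.ofMeasurable_apply s hs, if_neg h]

section
variable [T2Space X] [LocallyCompactSpace X] {κ : X → X → ℝ≥0∞}

theorem sigB_pot (hlsc : LowerSemicontinuous fun p : X × X => κ p.1 p.2) (hcons : Consistent κ)
    (μ : Measure X) [Good μ] (hE : mutE κ μ μ ≠ ⊤) (hE0 : mutE κ μ μ ≠ 0) :
    SigB {x | 0 < pot κ μ x} := by
  by_contra hns
  obtain ⟨l, hl1, hl2⟩ := exists_lam (X := X)
  have hpm := pot_meas hlsc μ
  have hv : VLim (pure ()) (fun _ : Unit => μ) (μ + l) := by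
    intro f hf1 hf2
    have h0 : f =ᵐ[l] 0 := by
      refine measure_mono_null ?_ (hl1 _ (hf2.isCompact).measurableSet (SigB.of_compact hf2.isCompact))
      intro x hx
      exact subset_tsupport f hx
    have : ∫ x, f x ∂(μ + l) = ∫ x, f x ∂μ := by
      rw [integral_add_measure (hf1.integrable_of_hasCompactSupport hf2)
        ((integrable_congr h0).2 (integrable_zero _ _ _)), integral_congr_ae h0]
      simp
    rw [this]
    exact tendsto_const_nhds
  have hd := cons_const hcons μ (μ + l) (lt_top_iff_ne_top.2 hE) hv
  have hy : mutE κ l μ = ⊤ := by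
    have hex : ∃ n : ℕ, ¬ SigB {x | ((n : ℝ≥0∞) + 1)⁻¹ ≤ pot κ μ x} := by
      by_contra! hall
      apply hns
      refine (SigB.iUnion hall).mono ?_
      intro x hx
      have hx' : pot κ μ x ≠ 0 := (pos_iff_ne_zero.1 hx)
      obtain ⟨n, hn⟩ := ENNReal.exists_inv_nat_lt hx'
      refine Set.mem_iUnion.2 ⟨n, ?_⟩
      exact le_trans (ENNReal.inv_le_inv.2 le_self_add) hn.le
    obtain ⟨n, hn⟩ := hex
    have h1 := hl2 _ (measurableSet_le measurable_const hpm) hn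
    have h2 := mul_meas_ge_le_lintegral (μ := l) hpm ((n : ℝ≥0∞) + 1)⁻¹
    rw [h1, ENNReal.mul_top (by simp)] at h2
    exact top_le_iff.1 h2
  have hμl : mutE κ μ (μ + l) = mutE κ μ μ + mutE κ μ l := mutE_add_right hlsc μ μ l
  have htop : mutE κ (μ + l) (μ + l) = ⊤ := by
    rw [mutE_add_left, mutE_add_right hlsc l μ l, hy]
    simp
  unfold distSq at hd
  rw [htop, hμl] at hd
  simp only [ENNReal.toReal_top, add_zero] at hd
  have hpos : 0 < (mutE κ μ μ).toReal := ENNReal.toReal_pos hE0 hE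
  by_cases hx : mutE κ μ l = ⊤
  · rw [hx] at hd
    simp at hd
    linarith
  · rw [ENNReal.toReal_add hE hx] at hd
    have := ENNReal.toReal_nonneg (a := mutE κ μ l)
    linarith

theorem scaled_lower {A : Set X} {c₀ : ℝ≥0∞}
    (hc : ∀ ν : Measure X, ν Aᶜ = 0 → ν A = 1 → c₀ ≤ mutE κ ν ν)
    (S : Measure X) [IsFiniteMeasure S] (hS : S Aᶜ = 0) (h0 : S Set.univ ≠ 0) :
    S Set.univ ^ 2 * c₀ ≤ mutE κ S S := by
  set m := S Set.univ with hm
  have hmt : m ≠ ⊤ := measure_ne_top S _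
  have hSA : S A = m := by
    refine le_antisymm (measure_mono (Set.subset_univ _)) ?_
    rw [hm, ← Set.union_compl_self A]
    exact (measure_union_le _ _).trans (by rw [hS, add_zero])
  have h1 := hc (m⁻¹ • S) (by simp [hS]) (by simp [hSA, ENNReal.inv_mul_cancel h0 hmt])
  rw [energy_smul' _ (ENNReal.inv_ne_top.2 h0)] at h1
  calc m ^ 2 * c₀ ≤ m ^ 2 * (m⁻¹ ^ 2 * mutE κ S S) := by gcongr
    _ = (m * m⁻¹) ^ 2 * mutE κ S S := by ring
    _ = mutE κ S S := by rw [ENNReal.mul_inv_cancel h0 hmt]; simp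

theorem caseA (hsym : ∀ x y, κ x y = κ y x)
    (hlsc : LowerSemicontinuous fun p : X × X => κ p.1 p.2) (hcons : Consistent κ)
    {A : Set X} (hcap : cap κ A < ⊤)
    (hA : ∀ C : ℕ → Set X, (∀ n, IsCompact (C n)) → ∃ σ : Measure X, Good σ ∧ σ Set.univ = 1 ∧
      σ Aᶜ = 0 ∧ mutE κ σ σ ≠ ⊤ ∧ ∀ n, σ (C n) = 0) : False := by
  obtain ⟨c₀, hc0, hct, hc⟩ := cap_lower hcap
  obtain ⟨M, hM⟩ : ∃ M : ℕ, ∀ C : ℕ → Set X, (∀ n, IsCompact (C n)) → ∃ σ : Measure X, Good σ ∧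
      σ Set.univ = 1 ∧ σ Aᶜ = 0 ∧ mutE κ σ σ ≤ M ∧ ∀ n, σ (C n) = 0 := by
    by_contra! hall
    choose C hC1 hC2 using hall
    obtain ⟨σ, h1, h2, h3, h4, h5⟩ := hA (fun k => C k.unpair.1 k.unpair.2) (fun k => hC1 _ _)
    obtain ⟨M, hM⟩ := ENNReal.exists_nat_gt h4
    obtain ⟨n, hn⟩ := hC2 M σ h1 h2 h3 hM.le
    have := h5 (Nat.pair M n)
    simp at this
    exact hn this
  have hind : ∀ n : ℕ, ∃ S : Measure X, Good S ∧ S Set.univ = n ∧ S Aᶜ = 0 ∧ mutE κ S S ≤ n * M := by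
    intro n
    induction n with
    | zero => exact ⟨0, inferInstance, by simp, by simp, by simp [mutE]⟩
    | succ n ih =>
      obtain ⟨S, h1, h2, h3, h4⟩ := ih
      have hSt : mutE κ S S ≠ ⊤ := ne_top_of_le_ne_top
        (ENNReal.mul_ne_top (by simp) (by simp)) h4
      have hsig : SigB {x | 0 < pot κ S x} := by
        by_cases hE0 : mutE κ S S = 0
        · have hu : S Set.univ = 0 := by
            by_contra hne
            have := scaled_lower hc S h3 hne
            rw [hE0] at this
            have h6 := le_antisymm this bot_le
            simp [hne, hc0] at h6
          have : S = 0 := Measure.measure_univ_eq_zero.1 hu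
          refine ⟨fun _ => ∅, fun _ => isCompact_empty, ?_⟩
          simp [this, pot]
        · exact sigB_pot hlsc hcons S hSt hE0
      obtain ⟨C, hC1, hC2⟩ := hsig
      obtain ⟨σ, g1, g2, g3, g4, g5⟩ := hM C hC1
      refine ⟨S + σ, inferInstance, by simp [h2, g2], by simp [h3, g3], ?_⟩
      have hcr : mutE κ S σ = 0 := by
        rw [mutE_comm κ hsym hlsc]
        unfold mutE
        rw [lintegral_eq_zero_iff (pot_meas hlsc S)]
        refine measure_mono_null ?_ (measure_iUnion_null g5)
        intro x hx
        exact hC2 (pos_iff_ne_zero.2 hx)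
      rw [energy_add hsym hlsc, hcr, mul_zero, add_zero]
      push_cast
      rw [add_mul, one_mul]
      exact add_le_add h4 g4
  obtain ⟨n, hn⟩ := ENNReal.exists_nat_mul_gt hc0 (b := M) (by simp)
  have hn0 : n ≠ 0 := by rintro rfl; simp at hn
  obtain ⟨S, h1, h2, h3, h4⟩ := hind n
  have h5 := scaled_lower hc S h3 (by rw [h2]; exact_mod_cast hn0)
  rw [h2] at h5
  have h6 := h5.trans h4
  rw [pow_two, mul_assoc] at h6
  have h7 := (ENNReal.mul_le_mul_iff_right (by exact_mod_cast hn0) (by simp)).1 h6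
  exact absurd h7 (not_le.2 hn)

theorem lemmaG (hsym : ∀ x y, κ x y = κ y x)
    (hlsc : LowerSemicontinuous fun p : X × X => κ p.1 p.2) (hcons : Consistent κ)
    {A : Set X} (hA : IsClosed A) (hcap : cap κ A < ⊤) (θ : Set X → Measure X)
    (hθmin : ∀ K : Set X, IsCompact K → K ⊆ A →
      ∀ a b : Measure X, FinE κ a → FinE κ b → mutE κ a b < ⊤ →
        cap κ {x ∈ A \ K | pot κ a x < 1 + pot κ b x} = 0 →
        (mutE κ (θ K) (θ K)).toReal ≤ distSq κ a b)
    (L : ℝ) (hL : 0 < L)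
    (hneg : ∀ K₀ : Set X, IsCompact K₀ → K₀ ⊆ A → ∃ K : Set X, IsCompact K ∧ K₀ ⊆ K ∧ K ⊆ A ∧
      L ≤ (mutE κ (θ K) (θ K)).toReal)
    (Q : Set X) (hQ : IsCompact Q) (a : Measure X) [Good a] (ha : mutE κ a a ≤ ENNReal.ofReal (L / 16)) :
    ∃ σ : Measure X, Good σ ∧ σ Set.univ = 1 ∧ σ {x ∈ A \ Q | pot κ a x < 1 / 2}ᶜ = 0 ∧
      mutE κ σ σ ≤ ENNReal.ofReal (32 / L) := by
  by_contra! hall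
  obtain ⟨P, hP1, hP2, hP3⟩ := lemmaGamma hsym hlsc (A \ Q) a (ENNReal.ofReal (32 / L))
    (by simp; positivity) (fun σ h1 h2 h3 => (hall σ h1 h2 h3).le)
  obtain ⟨Q', hQ'1, hQ'2⟩ := exists_compact_superset hQ
  obtain ⟨K, hK1, hK2, hK3, hK4⟩ := hneg (A ∩ Q') (hQ'1.inter_left hA) Set.inter_subset_left
  have hg2 : Good ((2 : ℝ≥0∞) • P) := goodSmul' _ _ (by norm_num)
  have hset : ∀ x, pot κ ((2 : ℝ≥0∞) • P) x < 1 ↔ pot κ P x < 1 / 2 := by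
    intro x
    rw [pot_smul, ENNReal.lt_div_iff_mul_lt (by simp) (by simp), mul_comm]
  have hR := lemmaR hlsc hcons hA hcap ((2 : ℝ≥0∞) • P) Q Q' hQ hQ'2 (by
    intro σ h1 h2 h3
    simp_rw [hset] at h3
    exact hP3 σ h1 h2 h3) K hK2
  have hE : mutE κ ((2 : ℝ≥0∞) • P) ((2 : ℝ≥0∞) • P) ≤ ENNReal.ofReal (3 * L / 4) := by
    rw [energy_smul hlsc]
    have h1 : mutE κ P P ≤ ENNReal.ofReal (3 * L / 16) := by
      refine hP2.trans ((add_le_add_left ha _).trans ?_)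
      rw [← ENNReal.ofReal_inv_of_pos (by positivity), show (4 : ℝ≥0∞) = ENNReal.ofReal 4 by simp,
        ← ENNReal.ofReal_mul (by norm_num), ← ENNReal.ofReal_add (by positivity) (by positivity)]
      refine ENNReal.ofReal_le_ofReal (le_of_eq ?_)
      field_simp
      norm_num
    refine (mul_le_mul_right h1 _).trans ?_
    rw [show ((2 : ℝ≥0∞) ^ 2) = ENNReal.ofReal 4 by norm_num, ← ENNReal.ofReal_mul (by norm_num)]
    refine ENNReal.ofReal_le_ofReal (le_of_eq ?_)
    ring
  have hpot0 : ∀ x, pot κ (0 : Measure X) x = 0 := fun x => by simp [pot]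
  have h00 : ∀ μ : Measure X, mutE κ μ 0 = 0 := fun μ => by simp [mutE, hpot0]
  have hfin := hθmin K hK1 hK3 ((2 : ℝ≥0∞) • P) 0 (lt_of_le_of_lt hE ENNReal.ofReal_lt_top)
    (by rw [FinE, h00]; simp) (by rw [h00]; simp) (by simpa [hpot0] using hR)
  have hd : distSq κ ((2 : ℝ≥0∞) • P) 0 ≤ 3 * L / 4 := by
    unfold distSq
    rw [h00, h00]
    simp only [ENNReal.toReal_zero, add_zero, mul_zero, sub_zero]
    exact ENNReal.toReal_le_of_le_ofReal (by positivity) hE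
  linarith
end

section
variable {κ : X → X → ℝ≥0∞} [T2Space X] [LocallyCompactSpace X]

/-- One step of the construction in the second case. -/
theorem nextS (hsym : ∀ x y, κ x y = κ y x)
    (hlsc : LowerSemicontinuous fun p : X × X => κ p.1 p.2)
    {A : Set X} (L : ℝ) (hL : 0 < L) (M₀ : ℝ≥0∞) (hM₀ : M₀ ≠ ⊤) (Q : Set X)
    (hG : ∀ a : Measure X, Good a → mutE κ a a ≤ ENNReal.ofReal (L / 16) →
      ∃ σ : Measure X, Good σ ∧ σ Set.univ = 1 ∧ σ {x ∈ A \ Q | pot κ a x < 1 / 2}ᶜ = 0 ∧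
      mutE κ σ σ ≤ M₀) (S : Measure X) (hS : Good S) (hE : mutE κ S S ≠ ⊤) :
    ∃ σ : Measure X, Good σ ∧ σ Set.univ = 1 ∧ σ Aᶜ = 0 ∧ σ Q = 0 ∧ mutE κ σ σ ≤ M₀ ∧
      mutE κ (S + σ) (S + σ) ≠ ⊤ := by
  set e := (mutE κ S S).toReal with he
  have he0 : 0 ≤ e := ENNReal.toReal_nonneg
  set r : ℝ := min 1 (L / 16 / (e + 1)) with hr
  have hr0 : 0 < r := lt_min one_pos (by positivity)
  have hr1 : r ≤ 1 := min_le_left _ _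
  have hr2 : r * (e + 1) ≤ L / 16 := by
    rw [← le_div_iff₀ (by positivity)]; exact min_le_right _ _
  set c : ℝ≥0∞ := ENNReal.ofReal r with hc
  have hc0 : c ≠ 0 := by simpa [hc] using hr0
  have hct : c ≠ ⊤ := ENNReal.ofReal_ne_top
  have hg : Good (c • S) := goodSmul' S c hct
  obtain ⟨σ, h1, h2, h3, h4⟩ := hG (c • S) hg (by
    rw [energy_smul' c hct S, ← ENNReal.ofReal_toReal hE, hc, ← ENNReal.ofReal_pow hr0.le,
      ← ENNReal.ofReal_mul (by positivity)]
    apply ENNReal.ofReal_le_ofReal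
    have : r ^ 2 ≤ r := by nlinarith
    nlinarith)
  have hfin : mutE κ σ S ≠ ⊤ := by
    have hle : mutE κ σ S ≤ ∫⁻ _, c⁻¹ * (1 / 2) ∂σ := by
      refine lintegral_mono_ae ?_
      have hae : ∀ᵐ x ∂σ, x ∈ {x ∈ A \ Q | pot κ (c • S) x < 1 / 2} := by
        rw [ae_iff]; exact h3
      filter_upwards [hae] with x hx
      have h5 : pot κ (c • S) x < 1 / 2 := hx.2
      rw [pot_smul] at h5
      calc pot κ S x = c⁻¹ * (c * pot κ S x) := by
            rw [← mul_assoc, ENNReal.inv_mul_cancel hc0 hct, one_mul]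
        _ ≤ _ := by gcongr
    refine ne_top_of_le_ne_top ?_ hle
    rw [lintegral_const, h2, mul_one]
    exact ENNReal.mul_ne_top (by simpa using hc0) (by simp)
  refine ⟨σ, h1, h2, measure_mono_null ?_ h3, measure_mono_null ?_ h3, h4, ?_⟩
  · exact Set.compl_subset_compl.2 fun x hx => hx.1.1
  · exact fun x hx hx' => hx'.1.2 hx
  · rw [energy_add hsym hlsc, mutE_comm κ hsym hlsc S σ]
    exact ENNReal.add_ne_top.2 ⟨ENNReal.add_ne_top.2 ⟨hE, ENNReal.mul_ne_top (by simp) hfin⟩,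
      ne_top_of_le_ne_top hM₀ h4⟩

theorem caseB (hsym : ∀ x y, κ x y = κ y x)
    (hlsc : LowerSemicontinuous fun p : X × X => κ p.1 p.2) (hpd : PosDefK κ)
    (hcons : Consistent κ)
    {A : Set X} (hA : IsClosed A) (hcap : cap κ A < ⊤) (L : ℝ) (hL : 0 < L)
    (M₀ : ℝ≥0∞) (hM₀ : M₀ ≠ ⊤)
    (hG : ∀ Q : Set X, IsCompact Q → ∀ a : Measure X, Good a →
      mutE κ a a ≤ ENNReal.ofReal (L / 16) →
      ∃ σ : Measure X, Good σ ∧ σ Set.univ = 1 ∧ σ {x ∈ A \ Q | pot κ a x < 1 / 2}ᶜ = 0 ∧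
      mutE κ σ σ ≤ M₀)
    (C : ℕ → Set X) (hC : ∀ n, IsCompact (C n))
    (hB : ¬ ∃ σ : Measure X, Good σ ∧ σ Set.univ = 1 ∧
      σ Aᶜ = 0 ∧ mutE κ σ σ ≠ ⊤ ∧ ∀ n, σ (C n) = 0) : False := by
  obtain ⟨c₀, hc0, hct, hc⟩ := cap_lower hcap
  choose D hD1 hD2 using fun n => exists_compact_superset (hC n)
  set Q : ℕ → Set X := fun n => ⋃ i ∈ Finset.range (n + 1), D i with hQ
  have hQc : ∀ n, IsCompact (Q n) := fun n => Finset.isCompact_biUnion _ fun i _ => hD1 i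
  have hQm : ∀ i n, i ≤ n → D i ⊆ Q n := fun i n h =>
    Set.subset_biUnion_of_mem (u := D) (Finset.mem_coe.2 (Finset.mem_range.2 (Nat.lt_succ_of_le h)))
  have hQmono : Monotone Q := fun n m h => Set.iUnion₂_subset fun i hi =>
    hQm i m ((Nat.le_of_lt_succ (Finset.mem_range.1 hi)).trans h)
  -- the recursion
  have step : ∀ n : ℕ, ∀ S : {S : Measure X // Good S ∧ mutE κ S S ≠ ⊤},
      ∃ S' : {S : Measure X // Good S ∧ mutE κ S S ≠ ⊤}, ∃ σ : Measure X, Good σ ∧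
        σ Set.univ = 1 ∧ σ Aᶜ = 0 ∧ σ (Q n) = 0 ∧ mutE κ σ σ ≤ M₀ ∧ S'.1 = S.1 + σ := by
    rintro n ⟨S, hS, hE⟩
    obtain ⟨σ, h1, h2, h3, h4, h5, h6⟩ := nextS hsym hlsc L hL M₀ hM₀ (Q n) (hG (Q n) (hQc n)) S hS hE
    exact ⟨⟨S + σ, inferInstance, h6⟩, σ, h1, h2, h3, h4, h5, rfl⟩
  choose F hF using step
  set S : ℕ → {S : Measure X // Good S ∧ mutE κ S S ≠ ⊤} :=
    fun n => Nat.rec ⟨0, goodZero, by simp [mutE]⟩ (fun n s => F n s) n with hSdef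
  have hSs : ∀ n, ∃ σ : Measure X, Good σ ∧
        σ Set.univ = 1 ∧ σ Aᶜ = 0 ∧ σ (Q n) = 0 ∧ mutE κ σ σ ≤ M₀ ∧ (S (n+1)).1 = (S n).1 + σ :=
    fun n => hF n (S n)
  have hSmono : Monotone fun n => (S n).1 := by
    refine monotone_nat_of_le_succ fun n => ?_
    obtain ⟨σ, -, -, -, -, -, h⟩ := hSs n
    rw [h]
    exact Measure.le_add_right le_rfl
  -- tails
  set T : ℕ → Set (Measure X) := fun n => {τ | Good τ ∧ τ Set.univ = 1 ∧ τ Aᶜ = 0 ∧ τ (Q n) = 0 ∧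
    ∃ N, ∃ c : ℝ≥0∞, c ≠ ⊤ ∧ τ ≤ c • (S N).1} with hT
  have hTanti : ∀ n m, n ≤ m → T m ⊆ T n := by
    rintro n m h τ ⟨h1, h2, h3, h4, h5⟩
    exact ⟨h1, h2, h3, measure_mono_null (hQmono h) h4, h5⟩
  have hTne : ∀ n, ∃ τ ∈ T n, mutE κ τ τ ≤ M₀ := by
    intro n
    obtain ⟨σ, h1, h2, h3, h4, h5, h⟩ := hSs n
    refine ⟨σ, ⟨h1, h2, h3, h4, n + 1, 1, by simp, ?_⟩, h5⟩
    rw [one_smul, h]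
    exact Measure.le_add_left le_rfl
  have hTfin : ∀ n τ τ', τ ∈ T n → τ' ∈ T n → mutE κ τ τ' ≠ ⊤ := by
    rintro n τ τ' ⟨-, -, -, -, N, c, hct, hle⟩ ⟨-, -, -, -, N', c', hct', hle'⟩
    have e1 : τ ≤ c • (S (max N N')).1 := hle.trans (by
      have := hSmono (le_max_left N N')
      intro s
      simp only [Measure.smul_apply, smul_eq_mul]
      gcongr)
    have e2 : τ' ≤ c' • (S (max N N')).1 := hle'.trans (by
      have := hSmono (le_max_right N N')
      intro s
      simp only [Measure.smul_apply, smul_eq_mul]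
      gcongr)
    have hg := (S (max N N')).2.1
    refine ne_top_of_le_ne_top ?_ (mutE_mono κ e1 e2)
    rw [mutE_smul_left, mutE_smul_right hlsc]
    exact ENNReal.mul_ne_top hct (ENNReal.mul_ne_top hct' (S (max N N')).2.2)
  have hTmid : ∀ n τ τ', τ ∈ T n → τ' ∈ T n → ((1 / 2 : ℝ≥0∞) • (τ + τ')) ∈ T n := by
    rintro n τ τ' ⟨g, a1, a2, a3, N, c, hct, hle⟩ ⟨g', b1, b2, b3, N', c', hct', hle'⟩
    refine ⟨goodSmul' _ _ (by simp), ?_, by simp [a2, b2], by simp [a3, b3], max N N', c + c',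
      ENNReal.add_ne_top.2 ⟨hct, hct'⟩, ?_⟩
    · simp only [Measure.smul_apply, Measure.add_apply, a1, b1, smul_eq_mul]
      rw [one_add_one_eq_two, one_div, ENNReal.inv_mul_cancel (by simp) (by simp)]
    · intro s
      have q1 := hle s
      have q2 := hle' s
      have q3 := hSmono (le_max_left N N') s
      have q4 := hSmono (le_max_right N N') s
      simp only [Measure.smul_apply, Measure.add_apply, smul_eq_mul] at *
      calc (1 / 2 : ℝ≥0∞) * (τ s + τ' s) ≤ 1 * (c * (S (max N N')).1 s + c' * (S (max N N')).1 s) := by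
            gcongr
            · simp
            · exact q1.trans (by gcongr)
            · exact q2.trans (by gcongr)
        _ = _ := by ring
  set E : Measure X → ℝ := fun τ => (mutE κ τ τ).toReal with hEdef
  have hE0 : ∀ τ, 0 ≤ E τ := fun τ => ENNReal.toReal_nonneg
  set d : ℕ → ℝ := fun n => sInf (E '' T n) with hd
  have hbdd : ∀ n, BddBelow (E '' T n) := fun n => ⟨0, by rintro _ ⟨τ, -, rfl⟩; exact hE0 τ⟩
  have hne : ∀ n, (E '' T n).Nonempty := fun n => by
    obtain ⟨τ, h, -⟩ := hTne n
    exact ⟨_, τ, h, rfl⟩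
  have hdle : ∀ n τ, τ ∈ T n → d n ≤ E τ := fun n τ h => csInf_le (hbdd n) ⟨τ, h, rfl⟩
  have hdm : Monotone d := fun n m h => csInf_le_csInf (hbdd n) (hne m) (Set.image_mono (hTanti n m h))
  have hdM : ∀ n, d n ≤ M₀.toReal := fun n => by
    obtain ⟨τ, h, h'⟩ := hTne n
    exact (hdle n τ h).trans (ENNReal.toReal_mono hM₀ h')
  have hch : ∀ n : ℕ, ∃ τ ∈ T n, E τ < d n + 1 / ((n : ℝ) + 1) := by
    intro n
    have : sInf (E '' T n) < d n + 1 / ((n : ℝ) + 1) := lt_add_of_pos_right _ (by positivity)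
    obtain ⟨_, ⟨τ, h, rfl⟩, h'⟩ := exists_lt_of_csInf_lt (hne n) this
    exact ⟨τ, h, h'⟩
  choose τ hτT hτE using hch
  have hgood : ∀ n, Good (τ n) := fun n => (hτT n).1
  have hfinE : ∀ n, mutE κ (τ n) (τ n) ≠ ⊤ := fun n => hTfin n _ _ (hτT n) (hτT n)
  have hds : ∀ n m, distSq κ (τ n) (τ m) ≤ 2 * (d n + 1 / ((n : ℝ) + 1)) +
      2 * (d m + 1 / ((m : ℝ) + 1)) - 4 * d (min n m) := by
    intro n m
    have m1 := hTanti _ _ (min_le_left n m) (hτT n)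
    have m2 := hTanti _ _ (min_le_right n m) (hτT m)
    have hmid := hdle _ _ (hTmid _ _ _ m1 m2)
    have hfx := hTfin _ _ _ m1 m2
    have hEm : E ((1 / 2 : ℝ≥0∞) • (τ n + τ m)) =
        (1 / 4) * (E (τ n) + 2 * (mutE κ (τ n) (τ m)).toReal + E (τ m)) := by
      simp only [hEdef]
      rw [energy_smul' _ (by simp), energy_add hsym hlsc, ENNReal.toReal_mul,
        ENNReal.toReal_add (ENNReal.add_ne_top.2 ⟨hfinE n, ENNReal.mul_ne_top (by simp) hfx⟩) (hfinE m),
        ENNReal.toReal_add (hfinE n) (ENNReal.mul_ne_top (by simp) hfx), ENNReal.toReal_mul]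
      norm_num
    rw [hEm] at hmid
    have h1 := hτE n
    have h2 := hτE m
    simp only [distSq]
    simp only [hEdef] at h1 h2 hmid
    linarith
  obtain ⟨D₀, hD₀⟩ : ∃ D₀, Tendsto d atTop (𝓝 D₀) :=
    ⟨_, tendsto_atTop_ciSup hdm ⟨M₀.toReal, by rintro _ ⟨n, rfl⟩; exact hdM n⟩⟩
  have hmin : Tendsto (fun p : ℕ × ℕ => min p.1 p.2) (atTop ×ˢ atTop) atTop := by
    refine tendsto_atTop.2 fun b => ?_
    have h1 := tendsto_fst (f := (atTop : Filter ℕ)) (g := (atTop : Filter ℕ)) |>.eventually_ge_atTop b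
    have h2 := tendsto_snd (f := (atTop : Filter ℕ)) (g := (atTop : Filter ℕ)) |>.eventually_ge_atTop b
    filter_upwards [h1, h2] with p a b using le_min a b
  have hd1 : Tendsto (fun n : ℕ => d n + 1 / ((n : ℝ) + 1)) atTop (𝓝 (D₀ + 0)) :=
    hD₀.add tendsto_one_div_add_atTop_nhds_zero_nat
  have hcau : Tendsto (fun p : ℕ × ℕ => distSq κ (τ p.1) (τ p.2)) (atTop ×ˢ atTop) (𝓝 0) := by
    refine squeeze_zero (fun p => hpd _ _ (lt_top_iff_ne_top.2 (hfinE _))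
      (lt_top_iff_ne_top.2 (hfinE _))) (fun p => hds p.1 p.2) ?_
    have := (((hd1.comp tendsto_fst).const_mul 2).add ((hd1.comp tendsto_snd).const_mul 2)).sub
      ((hD₀.comp hmin).const_mul 4)
    refine (this.congr fun p => rfl).trans_eq ?_
    ring_nf
  set U : Ultrafilter ℕ := hyperfilter ℕ with hU
  have hUle : (U : Filter ℕ) ≤ atTop := by
    rw [← Nat.cofinite_eq_atTop]; exact hyperfilter_le_cofinite
  obtain ⟨ν₀, hνg, hν1, hνl⟩ := exists_vlim U τ 1 (fun n => by rw [(hτT n).2.1]; simp)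
  have hνE : mutE κ ν₀ ν₀ ≠ ⊤ := by
    refine ne_top_of_le_ne_top (b := ENNReal.ofReal (M₀.toReal + 1)) ENNReal.ofReal_ne_top ?_
    refine hνl.energy_le hlsc 1 (fun n => by rw [(hτT n).2.1]; simp) hν1 _ fun n => ?_
    rw [← ENNReal.ofReal_toReal (hfinE n)]
    apply ENNReal.ofReal_le_ofReal
    have h1 := hτE n
    have h2 := hdM n
    have h3 : 1 / ((n : ℝ) + 1) ≤ 1 := by
      rw [div_le_one (by positivity)]; linarith [Nat.cast_nonneg (α := ℝ) n]
    simp only [hEdef] at h1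
    linarith
  have hνA : ν₀ Aᶜ = 0 := hνl.open_null _ hA.isOpen_compl (Eventually.of_forall fun n => (hτT n).2.2.1)
  have hνC : ∀ n, ν₀ (C n) = 0 := fun n => by
    refine measure_mono_null (hD2 n) (hνl.open_null _ isOpen_interior ?_)
    filter_upwards [hUle (eventually_ge_atTop n)] with s hs
    exact measure_mono_null (interior_subset.trans (hQm n s hs)) (hτT s).2.2.2.1
  have hν0 : ν₀ = 0 := by
    by_contra hne0
    have hTm : MeasurableSet (A \ ⋃ n, C n) :=
      hA.measurableSet.diff (MeasurableSet.iUnion fun n => (hC n).measurableSet)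
    have hTc : ν₀ (A \ ⋃ n, C n)ᶜ = 0 := by
      rw [Set.sdiff_eq, Set.compl_inter, compl_compl]
      exact measure_union_null hνA (measure_iUnion_null hνC)
    obtain ⟨σ, s1, s2, s3, s4⟩ := normalizeMeas hlsc ν₀ (A \ ⋃ n, C n) hTm (fun h => by
      apply hne0
      rw [← Measure.measure_univ_eq_zero, ← Set.union_compl_self (A \ ⋃ n, C n)]
      exact measure_union_null h hTc) hνE
    refine hB ⟨σ, s1, s2, measure_mono_null ?_ s3, s4, fun n => measure_mono_null ?_ s3⟩
    · exact Set.compl_subset_compl.2 fun x hx => hx.1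
    · exact fun x hx hx' => hx'.2 (Set.mem_iUnion.2 ⟨n, hx⟩)
  have hlim := hcons ℕ U inferInstance τ (fun n => lt_top_iff_ne_top.2 (hfinE n))
    (hcau.mono_left (Filter.prod_mono hUle hUle)) ν₀ hνl.cluster
  rw [hν0] at hlim
  have hle : ∀ n, c₀.toReal ≤ distSq κ (τ n) 0 := fun n => by
    have h1 : τ n A = 1 := by
      have := measure_add_measure_compl (μ := τ n) hA.measurableSet
      rw [(hτT n).2.2.1, (hτT n).2.1, add_zero] at this
      exact this
    have h2 := ENNReal.toReal_mono (hfinE n) (hc (τ n) (hτT n).2.2.1 h1)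
    have h3 : distSq κ (τ n) 0 = (mutE κ (τ n) (τ n)).toReal := by
      simp [distSq, mutE, pot]
    rw [h3]; exact h2
  have := ge_of_tendsto' hlim hle
  have := ENNReal.toReal_pos hc0 hct
  linarith

end

/-- Let `κ` be a consistent positive definite kernel on a
(noncompact) locally compact Hausdorff space `X`, and `A_j` closed with
`C(A_j) < ∞`.  For compact `K ⊆ A_j` let `θ K` be the interior equilibrium
measure of `K^c = A_j \ K`: it is concentrated on the closure of `A_j \ K`,
has total mass and energy equal to `C(A_j \ K)`, potential `≥ 1` nearly
everywhere on `A_j \ K` and `≤ 1` on its support, and it minimizes the energy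
over the class `Γ_{A_j \ K}` of (signed) finite-energy measures `a − b` whose
potential is `≥ 1` nearly everywhere on `A_j \ K`.  Then
`lim_{K ↑ A_j} ‖θ K‖ = 0` along the increasing filtered family of compact
subsets of `A_j`. -/
theorem stmt12 [T2Space X] [LocallyCompactSpace X] (hX : ¬ CompactSpace X)
    (κ : X → X → ℝ≥0∞)
    (hsym : ∀ x y, κ x y = κ y x)
    (hlsc : LowerSemicontinuous fun p : X × X => κ p.1 p.2)
    (hpd : PosDefK κ)
    (hcons : Consistent κ)
    (Aj : Set X) (hAj : IsClosed Aj) (hcapfin : cap κ Aj < ⊤)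
    (θ : Set X → Measure X)
    (hθconc : ∀ K : Set X, IsCompact K → K ⊆ Aj → θ K (closure (Aj \ K))ᶜ = 0)
    (hθmass : ∀ K : Set X, IsCompact K → K ⊆ Aj → θ K Set.univ = cap κ (Aj \ K))
    (hθener : ∀ K : Set X, IsCompact K → K ⊆ Aj →
      mutE κ (θ K) (θ K) = cap κ (Aj \ K))
    (hθpot : ∀ K : Set X, IsCompact K → K ⊆ Aj →
      cap κ {x ∈ Aj \ K | pot κ (θ K) x < 1} = 0)
    (hθsup : ∀ K : Set X, IsCompact K → K ⊆ Aj →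
      ∀ x ∈ msupport (θ K), pot κ (θ K) x ≤ 1)
    (hθmin : ∀ K : Set X, IsCompact K → K ⊆ Aj →
      ∀ a b : Measure X, FinE κ a → FinE κ b → mutE κ a b < ⊤ →
        cap κ {x ∈ Aj \ K | pot κ a x < 1 + pot κ b x} = 0 →
        (mutE κ (θ K) (θ K)).toReal ≤ distSq κ a b) :
    ∀ ε > (0 : ℝ), ∃ K₀ : Set X, IsCompact K₀ ∧ K₀ ⊆ Aj ∧
      ∀ K : Set X, IsCompact K → K₀ ⊆ K → K ⊆ Aj →
        Real.sqrt (mutE κ (θ K) (θ K)).toReal < ε := by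
  intro ε hε
  by_contra hcon
  push Not at hcon
  have hneg : ∀ K₀ : Set X, IsCompact K₀ → K₀ ⊆ Aj → ∃ K : Set X, IsCompact K ∧ K₀ ⊆ K ∧ K ⊆ Aj ∧
      ε ^ 2 ≤ (mutE κ (θ K) (θ K)).toReal := by
    intro K₀ h1 h2
    obtain ⟨K, k1, k2, k3, k4⟩ := hcon K₀ h1 h2
    exact ⟨K, k1, k2, k3, (Real.le_sqrt' hε).1 k4⟩
  by_cases hcase : ∀ C : ℕ → Set X, (∀ n, IsCompact (C n)) → ∃ σ : Measure X, Good σ ∧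
      σ Set.univ = 1 ∧ σ Ajᶜ = 0 ∧ mutE κ σ σ ≠ ⊤ ∧ ∀ n, σ (C n) = 0
  · exact caseA hsym hlsc hcons hcapfin hcase
  · rw [not_forall] at hcase
    obtain ⟨C, hC⟩ := hcase
    rw [Classical.not_imp] at hC
    exact caseB hsym hlsc hpd hcons hAj hcapfin (ε ^ 2) (by positivity)
      (ENNReal.ofReal (32 / ε ^ 2)) ENNReal.ofReal_ne_top
      (fun Q hQ a _ ha => lemmaG hsym hlsc hcons hAj hcapfin θ hθmin (ε ^ 2) (by positivity) hneg
        Q hQ a ha) C hC.1 hC.2
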